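/- Let λ : ℕ → ℂ be a multiplicative function with |λ(n)| ≤ τ(n) for all n (τ the divisor function). Let Q(x) = ax² + bx + c be an integer-valued quadratic polynomial with a ≠ 0 and no rational roots. Then for all X ≥ 3, ∑_{n ≤ X} |λ(|Q(n)|)| ≪_ε max(|a|,|b|,|c|)^{O(1)} · X · exp(∑_{split p ≤ X} (2(|λ(p)|-1) + ε)/p), where 'split' means the discriminant b²-4ac is a nonzero square mod p and p does not divide 2a(b²-4ac). -/

import Mathlib

open scoped Classical

lemma sum_log_div_primes_le (n : ℕ) (hn : 1 ≤ n) :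
    ∑ p ∈ (Finset.Icc 1 n).filter Nat.Prime, Real.log p / p ≤ 2 * Real.log n := by
  have h1 : ∀ m ∈ Finset.Icc 1 n,
      ∑ p ∈ (Finset.Icc 1 n).filter (fun p : ℕ => p.Prime ∧ p ∣ m), Real.log p ≤ Real.log n := by
    intro m hm
    rw [Finset.mem_Icc] at hm
    have hsub : (Finset.Icc 1 n).filter (fun p : ℕ => p.Prime ∧ p ∣ m) = m.primeFactors := by
      ext p
      simp only [Finset.mem_filter, Finset.mem_Icc, Nat.mem_primeFactors]
      constructor
      · rintro ⟨-, hp, hd⟩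
        exact ⟨hp, hd, by omega⟩
      · rintro ⟨hp, hd, h0⟩
        exact ⟨⟨hp.one_le, (Nat.le_of_dvd (by omega) hd).trans hm.2⟩, hp, hd⟩
    rw [hsub, ← Real.log_prod (fun p hp => by
      have := (Nat.prime_of_mem_primeFactors hp).pos
      positivity)]
    have hle : (∏ p ∈ m.primeFactors, p) ≤ m := Nat.le_of_dvd (by omega) (Nat.prod_primeFactors_dvd m)
    have hpos : 0 < ∏ p ∈ m.primeFactors, p :=
      Finset.prod_pos fun p hp => (Nat.prime_of_mem_primeFactors hp).pos
    rw [← Nat.cast_prod]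
    exact Real.log_le_log (by exact_mod_cast hpos) (by exact_mod_cast hle.trans hm.2)
  have h2 := Finset.sum_le_sum h1
  simp only [Finset.sum_const, Nat.card_Icc, Nat.add_sub_cancel, nsmul_eq_mul] at h2
  have h3 : ∑ m ∈ Finset.Icc 1 n,
      ∑ p ∈ (Finset.Icc 1 n).filter (fun p : ℕ => p.Prime ∧ p ∣ m), Real.log p =
      ∑ p ∈ (Finset.Icc 1 n).filter Nat.Prime, ((n / p : ℕ) : ℝ) * Real.log p := by
    simp_rw [Finset.sum_filter]
    rw [Finset.sum_comm]
    refine Finset.sum_congr rfl fun p _ => ?_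
    by_cases hp : p.Prime
    · simp only [hp, true_and, if_true]
      rw [← Finset.sum_filter, Finset.sum_const, nsmul_eq_mul]
      congr 2
      rw [← Nat.Ioc_filter_dvd_card_eq_div]
      rfl
    · simp [hp]
  rw [h3] at h2
  have hn0 : (0 : ℝ) < n := by exact_mod_cast hn
  have h4 : (n : ℝ) / 2 * ∑ p ∈ (Finset.Icc 1 n).filter Nat.Prime, Real.log p / p ≤
      ∑ p ∈ (Finset.Icc 1 n).filter Nat.Prime, ((n / p : ℕ) : ℝ) * Real.log p := by
    rw [Finset.mul_sum]
    refine Finset.sum_le_sum fun p hp => ?_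
    simp only [Finset.mem_filter, Finset.mem_Icc] at hp
    have hp0 : (0 : ℝ) < p := by exact_mod_cast hp.2.pos
    have hlog : 0 ≤ Real.log p := Real.log_natCast_nonneg p
    have hq : n ≤ 2 * ((n / p) * p) := by
      have h5 := Nat.div_add_mod n p
      have h6 := Nat.mod_lt n hp.2.pos
      have h7 : 1 ≤ n / p := Nat.div_pos hp.1.2 hp.2.pos
      nlinarith
    have hq' : (n : ℝ) ≤ 2 * (((n / p : ℕ) : ℝ) * p) := by exact_mod_cast hq
    have : (n : ℝ) / 2 / p ≤ ((n / p : ℕ) : ℝ) := by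
      rw [div_div, div_le_iff₀ (by positivity)]
      linarith
    calc (n : ℝ) / 2 * (Real.log p / p) = (n : ℝ) / 2 / p * Real.log p := by ring
      _ ≤ _ := by gcongr
  have h5 := h4.trans h2
  have h6 : (n : ℝ) * (∑ p ∈ (Finset.Icc 1 n).filter Nat.Prime, Real.log p / p) ≤
      n * (2 * Real.log n) := by linarith
  exact le_of_mul_le_mul_left h6 hn0

lemma sum_inv_primes_le {w : ℝ} (hw : 1 < w) (k n : ℕ) (hn : (n : ℝ) ≤ w ^ (2 ^ k)) :
    ∑ p ∈ (Finset.Icc 1 n).filter (fun p : ℕ => p.Prime ∧ w < p), (1 : ℝ) / p ≤ 4 * k := by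
  induction k generalizing w with
  | zero =>
    rw [Finset.sum_eq_zero]
    · simp
    · intro p hp
      simp only [Finset.mem_filter, Finset.mem_Icc] at hp
      have : (p : ℝ) ≤ n := by exact_mod_cast hp.1.2
      simp only [pow_zero, pow_one] at hn
      linarith [hp.2.2]
  | succ k ih =>
    have hlw : 0 < Real.log w := Real.log_pos hw
    have hw2 : 1 < w ^ 2 := one_lt_pow₀ hw (by norm_num)
    have h1 := ih hw2 (by rw [← pow_mul, ← pow_succ']; exact hn)
    set m : ℕ := ⌊w ^ 2⌋₊ with hm
    have hm1 : 1 ≤ m := Nat.le_floor (by exact_mod_cast hw2.le)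
    have h2 : ∑ p ∈ (Finset.Icc 1 m).filter (fun p : ℕ => p.Prime ∧ w < p), (1 : ℝ) / p ≤ 4 := by
      have h3 : Real.log w * ∑ p ∈ (Finset.Icc 1 m).filter (fun p : ℕ => p.Prime ∧ w < p), (1 : ℝ) / p
          ≤ 2 * Real.log m := by
        refine le_trans ?_ (sum_log_div_primes_le m hm1)
        rw [Finset.mul_sum]
        refine (Finset.sum_le_sum fun p hp => ?_).trans
          (Finset.sum_le_sum_of_subset_of_nonneg (t := (Finset.Icc 1 m).filter Nat.Prime)
            (fun p hp => ?_) fun p _ _ => ?_)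
        · simp only [Finset.mem_filter, Finset.mem_Icc] at hp
          have hp0 : (0 : ℝ) < p := by exact_mod_cast hp.2.1.pos
          have : Real.log w ≤ Real.log p := Real.log_le_log (by linarith) hp.2.2.le
          rw [mul_one_div]
          gcongr
        · simp only [Finset.mem_filter] at hp ⊢
          exact ⟨hp.1, hp.2.1⟩
        · have := Real.log_natCast_nonneg p
          positivity
      have h4 : Real.log m ≤ 2 * Real.log w := by
        have : Real.log m ≤ Real.log (w ^ 2) :=
          Real.log_le_log (by exact_mod_cast hm1) (Nat.floor_le (by positivity))
        rwa [Real.log_pow] at this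
      have h5 : Real.log w * ∑ p ∈ (Finset.Icc 1 m).filter (fun p : ℕ => p.Prime ∧ w < p), (1 : ℝ) / p
          ≤ Real.log w * 4 := by linarith
      exact le_of_mul_le_mul_left h5 hlw
    have h6 : ∑ p ∈ (Finset.Icc 1 n).filter (fun p : ℕ => p.Prime ∧ w < p), (1 : ℝ) / p ≤
        ∑ p ∈ (Finset.Icc 1 m).filter (fun p : ℕ => p.Prime ∧ w < p), (1 : ℝ) / p +
        ∑ p ∈ (Finset.Icc 1 n).filter (fun p : ℕ => p.Prime ∧ w ^ 2 < p), (1 : ℝ) / p := by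
      refine le_trans ?_ (Finset.sum_union_inter (s₁ := (Finset.Icc 1 m).filter
        (fun p : ℕ => p.Prime ∧ w < p)) (s₂ := (Finset.Icc 1 n).filter
        (fun p : ℕ => p.Prime ∧ w ^ 2 < p)) (f := fun p : ℕ => (1 : ℝ) / p)).le
      refine le_add_of_le_of_nonneg ?_ (Finset.sum_nonneg fun _ _ => by positivity)
      refine Finset.sum_le_sum_of_subset_of_nonneg ?_ fun _ _ _ => by positivity
      intro p hp
      simp only [Finset.mem_filter, Finset.mem_Icc, Finset.mem_union] at hp ⊢
      by_cases h : w ^ 2 < p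
      · exact Or.inr ⟨hp.1, hp.2.1, h⟩
      · exact Or.inl ⟨⟨hp.1.1, Nat.le_floor (not_lt.mp h)⟩, hp.2⟩
    push_cast
    linarith

lemma card_divisors_le_of_rough {b : ℕ} (hb : b ≠ 0) {y : ℝ} (hy : 1 < y)
    (hrough : ∀ p, p.Prime → p ∣ b → y ≤ p) {N : ℕ} (hN : (b : ℝ) ≤ y ^ N) :
    b.divisors.card ≤ 2 ^ N := by
  have h1 : y ^ (∑ p ∈ b.primeFactors, b.factorization p) ≤ b := by
    have h2 : (b : ℝ) = ∏ p ∈ b.primeFactors, (p : ℝ) ^ b.factorization p := by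
      conv_lhs => rw [← Nat.prod_factorization_pow_eq_self hb]
      rw [Finsupp.prod, Nat.support_factorization]
      push_cast
      rfl
    rw [h2, ← Finset.prod_pow_eq_pow_sum]
    refine Finset.prod_le_prod (fun _ _ => by positivity) fun p hp => ?_
    have := hrough p (Nat.prime_of_mem_primeFactors hp) (Nat.dvd_of_mem_primeFactors hp)
    gcongr
  have h3 : ∑ p ∈ b.primeFactors, b.factorization p ≤ N :=
    (pow_le_pow_iff_right₀ hy).mp (h1.trans hN)
  rw [Nat.card_divisors hb]
  calc ∏ p ∈ b.primeFactors, (b.factorization p + 1)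
      ≤ ∏ p ∈ b.primeFactors, 2 ^ b.factorization p :=
        Finset.prod_le_prod' fun p _ => Nat.lt_two_pow_self
    _ = 2 ^ ∑ p ∈ b.primeFactors, b.factorization p := Finset.prod_pow_eq_pow_sum ..
    _ ≤ 2 ^ N := Nat.pow_le_pow_right (by norm_num) h3

lemma exists_card_divisors_le_rpow {θ : ℝ} (hθ : 0 < θ) :
    ∃ C : ℝ, 0 < C ∧ ∀ n : ℕ, (n.divisors.card : ℝ) ≤ C * (n : ℝ) ^ θ := by
  set K : ℝ := max 1 (1 / (θ * Real.log 2)) with hK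
  have hK1 : 1 ≤ K := le_max_left _ _
  have hl2 : 0 < Real.log 2 := Real.log_pos (by norm_num)
  obtain ⟨P, hP⟩ := exists_nat_ge ((2 : ℝ) ^ (1 / θ))
  refine ⟨K ^ P, by positivity, fun n => ?_⟩
  rcases eq_or_ne n 0 with rfl | hn
  · simp [Real.zero_rpow hθ.ne']
  have key : ∀ p ∈ n.primeFactors, ((n.factorization p + 1 : ℕ) : ℝ) ≤
      (if p < P then K else 1) * ((p : ℝ) ^ n.factorization p) ^ θ := by
    intro p hp
    have hpp := Nat.prime_of_mem_primeFactors hp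
    set v := n.factorization p
    have hp2 : (2 : ℝ) ≤ p := by exact_mod_cast hpp.two_le
    rw [← Real.rpow_natCast_mul (by positivity), mul_comm (v : ℝ) θ,
      Real.rpow_mul (by positivity), Real.rpow_natCast]
    push_cast
    split_ifs with h
    · have h1 : 1 + v * (θ * Real.log 2) ≤ ((p : ℝ) ^ θ) ^ v := by
        calc 1 + v * (θ * Real.log 2) ≤ Real.exp (v * (θ * Real.log 2)) := by
              linarith [Real.add_one_le_exp (v * (θ * Real.log 2))]
          _ = ((2 : ℝ) ^ θ) ^ v := by
              rw [Real.exp_nat_mul, Real.rpow_def_of_pos (by norm_num), mul_comm θ]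
          _ ≤ _ := by gcongr
      have h2 : 1 ≤ K * (θ * Real.log 2) := by
        have := le_max_right 1 (1 / (θ * Real.log 2))
        rw [← hK, div_le_iff₀ (by positivity)] at this
        exact this
      calc (v : ℝ) + 1 ≤ K * (1 + v * (θ * Real.log 2)) := by
            have : (v : ℝ) * 1 ≤ v * (K * (θ * Real.log 2)) := by gcongr
            nlinarith
        _ ≤ _ := by gcongr
    · rw [one_mul]
      have h1 : (2 : ℝ) ≤ (p : ℝ) ^ θ := by
        have h3 : (2 : ℝ) ^ (1 / θ) ≤ p := hP.trans (by exact_mod_cast not_lt.mp h)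
        calc (2 : ℝ) = ((2 : ℝ) ^ (1 / θ)) ^ θ := by
              rw [← Real.rpow_mul (by norm_num), one_div_mul_cancel hθ.ne', Real.rpow_one]
          _ ≤ _ := by gcongr
      calc (v : ℝ) + 1 ≤ 2 ^ v := by exact_mod_cast Nat.lt_two_pow_self (n := v)
        _ ≤ _ := by gcongr
  have hn' : (n : ℝ) = ∏ p ∈ n.primeFactors, (p : ℝ) ^ n.factorization p := by
    conv_lhs => rw [← Nat.prod_factorization_pow_eq_self hn]
    rw [Finsupp.prod, Nat.support_factorization]
    push_cast
    rfl
  rw [Nat.card_divisors hn, Nat.cast_prod]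
  refine (Finset.prod_le_prod (fun _ _ => by positivity) key).trans ?_
  rw [Finset.prod_mul_distrib, Real.finsetProd_rpow _ _ (fun _ _ => by positivity), ← hn']
  gcongr
  rw [Finset.prod_ite, Finset.prod_const, Finset.prod_const_one, mul_one]
  refine pow_le_pow_right₀ hK1 ?_
  calc _ ≤ (Finset.range P).card := Finset.card_le_card fun p hp => by
        simp only [Finset.mem_filter] at hp
        exact Finset.mem_range.mpr hp.2
    _ = P := Finset.card_range P

lemma two_pow_card_primeFactors_le {n : ℕ} (hn : n ≠ 0) : 2 ^ n.primeFactors.card ≤ n := by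
  calc 2 ^ n.primeFactors.card ≤ ∏ p ∈ n.primeFactors, p := by
        rw [← Finset.prod_const]
        exact Finset.prod_le_prod' fun p hp => (Nat.prime_of_mem_primeFactors hp).two_le
    _ ≤ n := Nat.le_of_dvd (by omega) (Nat.prod_primeFactors_dvd n)

lemma card_filter_range_mul_of_coprime {m n : ℕ} (hmn : m.Coprime n) (hm : 0 < m) (hn : 0 < n)
    {A B : Finset ℕ} (hA : A ⊆ Finset.range m) (hB : B ⊆ Finset.range n) :
    ((Finset.range (m * n)).filter (fun x => x % m ∈ A ∧ x % n ∈ B)).card = A.card * B.card := by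
  rw [← Finset.card_product]
  refine Finset.card_nbij (fun x => (x % m, x % n)) ?_ ?_ ?_
  · intro x hx
    simp only [Finset.coe_filter, Set.mem_ofPred_eq] at hx
    simpa using hx.2
  · intro x hx y hy hxy
    simp only [Finset.coe_filter, Finset.mem_range, Set.mem_ofPred_eq] at hx hy
    simp only [Prod.mk.injEq] at hxy
    have h := (Nat.modEq_and_modEq_iff_modEq_mul hmn).mp hxy
    exact Nat.ModEq.eq_of_lt_of_lt h hx.1 hy.1
  · rintro ⟨a, b⟩ hab
    simp only [Finset.coe_product, Set.mem_prod, Finset.mem_coe] at hab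
    have ha := Finset.mem_range.mp (hA hab.1)
    have hb := Finset.mem_range.mp (hB hab.2)
    have h := (Nat.chineseRemainder hmn a b).2
    have h1 : (Nat.chineseRemainder hmn a b : ℕ) % m = a := by rw [h.1, Nat.mod_eq_of_lt ha]
    have h2 : (Nat.chineseRemainder hmn a b : ℕ) % n = b := by rw [h.2, Nat.mod_eq_of_lt hb]
    refine ⟨Nat.chineseRemainder hmn a b, ?_, ?_⟩
    · simp only [Finset.coe_filter, Finset.mem_range, Set.mem_ofPred_eq, h1, h2]
      exact ⟨Nat.chineseRemainder_lt_mul hmn a b hm.ne' hn.ne', hab⟩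
    · simp only [h1, h2]

lemma card_filter_range_prod_primes (S : Finset ℕ) (hS : ∀ p ∈ S, p.Prime) (Ω : ℕ → Finset ℕ)
    (hΩ : ∀ p ∈ S, Ω p ⊆ Finset.range p) :
    ((Finset.range (∏ p ∈ S, p)).filter (fun x => ∀ p ∈ S, x % p ∈ Ω p)).card =
      ∏ p ∈ S, (Ω p).card := by
  induction S using Finset.induction_on with
  | empty => simp
  | insert q S hq ih =>
    have hS' : ∀ p ∈ S, p.Prime := fun p hp => hS p (Finset.mem_insert_of_mem hp)
    have ih' := ih hS' (fun p hp => hΩ p (Finset.mem_insert_of_mem hp))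
    have hqp := hS q (Finset.mem_insert_self _ _)
    have hcop : q.Coprime (∏ p ∈ S, p) := Nat.Coprime.prod_right fun p hp =>
      (Nat.coprime_primes hqp (hS' p hp)).mpr fun h => hq (h ▸ hp)
    rw [Finset.prod_insert hq, Finset.prod_insert hq, ← ih',
      ← card_filter_range_mul_of_coprime hcop hqp.pos (Finset.prod_pos fun p hp => (hS' p hp).pos)
        (hΩ q (Finset.mem_insert_self _ _)) (Finset.filter_subset _ _)]
    congr 1
    ext x
    simp only [Finset.mem_filter, Finset.mem_range, Finset.forall_mem_insert]
    refine and_congr_right fun _ => and_congr_right fun _ => ?_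
    constructor
    · intro h
      refine ⟨Nat.mod_lt _ (Finset.prod_pos fun p hp => (hS' p hp).pos), fun p hp => ?_⟩
      rw [Nat.mod_mod_of_dvd _ (Finset.dvd_prod_of_mem _ hp)]
      exact h p hp
    · rintro ⟨-, h⟩ p hp
      have := h p hp
      rwa [Nat.mod_mod_of_dvd _ (Finset.dvd_prod_of_mem _ hp)] at this

lemma abs_card_filter_range_mod_sub_le (N d : ℕ) (hd : 0 < d) (R : Finset ℕ)
    (hR : R ⊆ Finset.range d) :
    |(((Finset.range N).filter (fun x => x % d ∈ R)).card : ℝ) - N * (R.card / d)| ≤ R.card := by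
  have h1 : ((Finset.range N).filter (fun x => x % d ∈ R)).card =
      ∑ r ∈ R, ((Finset.range N).filter (fun x => x ≡ r [MOD d])).card := by
    rw [← Finset.card_biUnion]
    · congr 1
      ext x
      simp only [Finset.mem_filter, Finset.mem_biUnion, Finset.mem_range]
      constructor
      · rintro ⟨hx, hr⟩
        exact ⟨_, hr, hx, (Nat.mod_modEq x d).symm⟩
      · rintro ⟨r, hr, hx, hxr⟩
        refine ⟨hx, ?_⟩
        rwa [hxr, Nat.mod_eq_of_lt (Finset.mem_range.mp (hR hr))]
    · intro r hr s hs hrs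
      rw [Function.onFun, Finset.disjoint_left]
      intro x hx hx'
      simp only [Finset.mem_filter] at hx hx'
      exact hrs (Nat.ModEq.eq_of_lt_of_lt (hx.2.symm.trans hx'.2)
        (Finset.mem_range.mp (hR hr)) (Finset.mem_range.mp (hR hs)))
  have hd0 : (0 : ℝ) < d := by exact_mod_cast hd
  have h2 : ∀ r ∈ R, |((((Finset.range N).filter (fun x => x ≡ r [MOD d])).card : ℕ) : ℝ) - N / d|
      ≤ 1 := by
    intro r _
    rw [← Nat.count_eq_card_filter_range, Nat.count_modEq_card _ hd]
    have h3 : (N : ℝ) = d * (N / d : ℕ) + (N % d : ℕ) := by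
      exact_mod_cast (Nat.div_add_mod N d).symm
    have h4 : ((N % d : ℕ) : ℝ) < d := by exact_mod_cast Nat.mod_lt N hd
    have h5 : (N : ℝ) / d = (N / d : ℕ) + (N % d : ℕ) / d := by
      rw [h3]
      field_simp
    have h6 : ((N % d : ℕ) : ℝ) / d ≤ 1 := by rw [div_le_one hd0]; exact h4.le
    have h7 : (0 : ℝ) ≤ ((N % d : ℕ) : ℝ) / d := by positivity
    rw [h5, abs_le]
    push_cast
    split_ifs <;> constructor <;> linarith
  rw [h1, Nat.cast_sum]
  have h8 : (N : ℝ) * (R.card / d) = ∑ r ∈ R, (N : ℝ) / d := by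
    rw [Finset.sum_const, nsmul_eq_mul]; ring
  rw [h8, ← Finset.sum_sub_distrib]
  refine (Finset.abs_sum_le_sum_abs _ _).trans ((Finset.sum_le_sum h2).trans ?_)
  simp

lemma ite_eq_empty_le_sum_neg_one_pow (s : Finset ℕ) {h : ℕ} (hh : Even h) :
    (if s = ∅ then (1 : ℝ) else 0) ≤
      ∑ S ∈ s.powerset with S.card ≤ h, (-1 : ℝ) ^ S.card := by
  have h1 : ∑ S ∈ s.powerset with S.card ≤ h, (-1 : ℝ) ^ S.card =
      ((∑ j ∈ Finset.range (h + 1), ((-1) ^ j * (s.card.choose j : ℤ)) : ℤ) : ℝ) := by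
    rw [← Finset.sum_fiberwise_of_maps_to (s := s.powerset.filter _)
      (t := Finset.range (h + 1)) (g := Finset.card)]
    · push_cast
      refine Finset.sum_congr rfl fun j hj => ?_
      rw [Finset.mem_range] at hj
      have : (s.powerset.filter (fun S => S.card ≤ h)).filter (fun S => S.card = j) =
          s.powersetCard j := by
        ext S
        simp only [Finset.mem_filter, Finset.mem_powerset, Finset.mem_powersetCard]
        constructor
        · rintro ⟨⟨h1, h2⟩, h3⟩; exact ⟨h1, h3⟩
        · rintro ⟨h1, h3⟩; exact ⟨⟨h1, by omega⟩, h3⟩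
      rw [this, ← Finset.card_powersetCard, mul_comm, ← nsmul_eq_mul, ← Finset.sum_const]
      refine Finset.sum_congr rfl fun S hS => ?_
      rw [(Finset.mem_powersetCard.mp hS).2]
    · intro S hS
      have := (Finset.mem_filter.mp hS).2
      exact Finset.mem_range.mpr (by omega)
  rw [h1]
  split_ifs with hs
  · subst hs
    have : ∑ j ∈ Finset.range (h + 1), ((-1) ^ j * (((∅ : Finset ℕ).card).choose j : ℤ)) = 1 := by
      rw [Finset.sum_eq_single 0]
      · simp
      · intro j _ hj
        simp [Nat.choose_eq_zero_of_lt (Nat.pos_of_ne_zero hj)]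
      · simp
    rw [this]; simp
  · obtain ⟨n, hn⟩ := Nat.exists_eq_succ_of_ne_zero (Finset.card_ne_zero.mpr
      (Finset.nonempty_iff_ne_empty.mpr hs))
    rw [hn, Nat.succ_eq_add_one, Int.alternating_sum_range_choose_eq_choose, hh.neg_one_pow]
    push_cast
    positivity

lemma sum_powerset_two_pow_le (P : Finset ℕ) (h : ℕ) :
    ∑ S ∈ P.powerset with S.card ≤ h, (2 : ℝ) ^ S.card ≤ (2 * P.card + 1) ^ h := by
  rw [← Finset.sum_fiberwise_of_maps_to (s := P.powerset.filter _)
      (t := Finset.range (h + 1)) (g := Finset.card), add_pow]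
  · refine Finset.sum_le_sum fun j hj => ?_
    rw [Finset.mem_range] at hj
    have : (P.powerset.filter (fun S => S.card ≤ h)).filter (fun S => S.card = j) ⊆
        P.powersetCard j := by
      intro S
      simp only [Finset.mem_filter, Finset.mem_powerset, Finset.mem_powersetCard]
      rintro ⟨⟨h1, h2⟩, h3⟩; exact ⟨h1, h3⟩
    refine (Finset.sum_le_sum_of_subset_of_nonneg this fun _ _ _ => by positivity).trans ?_
    rw [Finset.sum_congr rfl (g := fun _ => (2 : ℝ) ^ j)
      (fun S hS => by rw [(Finset.mem_powersetCard.mp hS).2]), Finset.sum_const,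
      Finset.card_powersetCard, nsmul_eq_mul, one_pow, mul_one, mul_pow]
    have h1 : (P.card.choose j : ℝ) ≤ (P.card : ℝ) ^ j := by
      exact_mod_cast Nat.choose_le_pow P.card j
    have h2 : (1 : ℝ) ≤ h.choose j := by
      exact_mod_cast Nat.choose_pos (by omega : j ≤ h)
    calc (P.card.choose j : ℝ) * 2 ^ j ≤ (P.card : ℝ) ^ j * 2 ^ j := by gcongr
      _ = (2 : ℝ) ^ j * (P.card : ℝ) ^ j * 1 := by ring
      _ ≤ _ := by gcongr
  · intro S hS
    have := (Finset.mem_filter.mp hS).2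
    exact Finset.mem_range.mpr (by omega)

lemma truncated_sum_prod_le (P : Finset ℕ) (g : ℕ → ℝ) (hg : ∀ p ∈ P, 0 ≤ g p ∧ g p ≤ 1) (h : ℕ) :
    ∑ S ∈ P.powerset with S.card ≤ h, (-1 : ℝ) ^ S.card * ∏ p ∈ S, g p ≤
      Real.exp (-∑ p ∈ P, g p) + Real.exp (-h) * Real.exp (Real.exp 1 * ∑ p ∈ P, g p) := by
  have hnn : ∀ S ∈ P.powerset, 0 ≤ ∏ p ∈ S, g p := fun S hS =>
    Finset.prod_nonneg fun p hp => (hg p (Finset.mem_powerset.mp hS hp)).1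
  have h1 : ∑ S ∈ P.powerset, (-1 : ℝ) ^ S.card * ∏ p ∈ S, g p = ∏ p ∈ P, (1 - g p) := by
    have : ∏ p ∈ P, (1 - g p) = ∏ p ∈ P, (1 + (-1) * g p) := by
      refine Finset.prod_congr rfl fun p _ => by ring
    rw [this, Finset.prod_one_add]
    refine Finset.sum_congr rfl fun S _ => ?_
    rw [Finset.prod_mul_distrib, Finset.prod_const]
  have h2 : ∏ p ∈ P, (1 - g p) ≤ Real.exp (-∑ p ∈ P, g p) := by
    rw [← Finset.sum_neg_distrib, Real.exp_sum]
    refine Finset.prod_le_prod (fun p hp => by linarith [(hg p hp).2]) fun p _ => ?_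
    linarith [Real.add_one_le_exp (-g p)]
  have h3 : ∑ S ∈ P.powerset with ¬ S.card ≤ h, ∏ p ∈ S, g p ≤
      Real.exp (-h) * Real.exp (Real.exp 1 * ∑ p ∈ P, g p) := by
    calc ∑ S ∈ P.powerset with ¬ S.card ≤ h, ∏ p ∈ S, g p
        ≤ ∑ S ∈ P.powerset with ¬ S.card ≤ h,
            Real.exp (-h) * ∏ p ∈ S, (Real.exp 1 * g p) := by
          refine Finset.sum_le_sum fun S hS => ?_
          rw [Finset.mem_filter, not_le] at hS
          rw [Finset.prod_mul_distrib, Finset.prod_const, ← Real.exp_nat_mul, ← mul_assoc,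
            ← Real.exp_add]
          have : (h : ℝ) < S.card := by exact_mod_cast hS.2
          have h4 : 1 ≤ Real.exp (-h + S.card * 1) := Real.one_le_exp (by linarith)
          nlinarith [hnn S hS.1]
      _ ≤ ∑ S ∈ P.powerset, Real.exp (-h) * ∏ p ∈ S, (Real.exp 1 * g p) := by
          refine Finset.sum_le_sum_of_subset_of_nonneg (Finset.filter_subset _ _)
            fun S hS _ => ?_
          refine mul_nonneg (Real.exp_pos _).le (Finset.prod_nonneg fun p hp => ?_)
          exact mul_nonneg (Real.exp_pos _).le (hg p (Finset.mem_powerset.mp hS hp)).1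
      _ = Real.exp (-h) * ∏ p ∈ P, (1 + Real.exp 1 * g p) := by
          rw [← Finset.mul_sum, Finset.prod_one_add]
      _ ≤ _ := by
          rw [Finset.mul_sum, Real.exp_sum]
          gcongr with p hp
          · intro p hp
            have := (hg p hp).1
            positivity
          · linarith [Real.add_one_le_exp (Real.exp 1 * g p)]
  have h4 := Finset.sum_filter_add_sum_filter_not P.powerset (fun S => S.card ≤ h)
    (fun S => (-1 : ℝ) ^ S.card * ∏ p ∈ S, g p)
  have h5 : -∑ S ∈ P.powerset with ¬ S.card ≤ h, ∏ p ∈ S, g p ≤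
      ∑ S ∈ P.powerset with ¬ S.card ≤ h, (-1 : ℝ) ^ S.card * ∏ p ∈ S, g p := by
    rw [← Finset.sum_neg_distrib]
    refine Finset.sum_le_sum fun S hS => ?_
    have := hnn S (Finset.mem_filter.mp hS).1
    rcases neg_one_pow_eq_or ℝ S.card with h | h <;> rw [h] <;> linarith
  linarith

/-- Brun's pure sieve, removing two residue classes modulo each prime of `P`. -/
lemma brun_pure_sieve (N h : ℕ) (hh : Even h) (P : Finset ℕ) (hP : ∀ p ∈ P, p.Prime)
    (Ω : ℕ → Finset ℕ) (hΩ : ∀ p ∈ P, Ω p ⊆ Finset.range p) (hcard : ∀ p ∈ P, (Ω p).card = 2) :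
    (((Finset.range N).filter (fun m => ∀ p ∈ P, m % p ∉ Ω p)).card : ℝ) ≤
      N * (Real.exp (-∑ p ∈ P, (2 : ℝ) / p) +
        Real.exp (-h) * Real.exp (Real.exp 1 * ∑ p ∈ P, (2 : ℝ) / p)) +
      (2 * P.card + 1) ^ h := by
  have h1 : (((Finset.range N).filter (fun m => ∀ p ∈ P, m % p ∉ Ω p)).card : ℝ) ≤
      ∑ m ∈ Finset.range N, ∑ S ∈ P.powerset with S.card ≤ h,
        (-1 : ℝ) ^ S.card * (if ∀ p ∈ S, m % p ∈ Ω p then 1 else 0) := by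
    rw [Finset.card_filter, Nat.cast_sum]
    refine Finset.sum_le_sum fun m _ => ?_
    have h2 := ite_eq_empty_le_sum_neg_one_pow (P.filter (fun p => m % p ∈ Ω p)) hh
    simp only [Finset.filter_eq_empty_iff] at h2
    push_cast
    refine h2.trans (le_of_eq ?_)
    simp_rw [mul_ite, mul_one, mul_zero]
    rw [← Finset.sum_filter]
    refine Finset.sum_congr ?_ fun _ _ => rfl
    ext S
    simp only [Finset.mem_filter, Finset.mem_powerset, Finset.subset_iff]
    constructor
    · rintro ⟨h3, h4⟩
      exact ⟨⟨fun p hp => (h3 hp).1, h4⟩, fun p hp => (h3 hp).2⟩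
    · rintro ⟨⟨h3, h4⟩, h5⟩
      exact ⟨fun p hp => ⟨h3 hp, h5 p hp⟩, h4⟩
  rw [Finset.sum_comm] at h1
  have h2 : ∀ S ∈ P.powerset.filter (fun S => S.card ≤ h),
      ∑ m ∈ Finset.range N, (-1 : ℝ) ^ S.card * (if ∀ p ∈ S, m % p ∈ Ω p then 1 else 0) ≤
      N * ((-1 : ℝ) ^ S.card * ∏ p ∈ S, (2 : ℝ) / p) + 2 ^ S.card := by
    intro S hS
    rw [Finset.mem_filter, Finset.mem_powerset] at hS
    have hSp : ∀ p ∈ S, p.Prime := fun p hp => hP p (hS.1 hp)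
    have hd : 0 < ∏ p ∈ S, p := Finset.prod_pos fun p hp => (hSp p hp).pos
    set R := (Finset.range (∏ p ∈ S, p)).filter (fun x => ∀ p ∈ S, x % p ∈ Ω p) with hR
    have hRc : R.card = 2 ^ S.card := by
      rw [hR, card_filter_range_prod_primes S hSp Ω (fun p hp => hΩ p (hS.1 hp)),
        Finset.prod_congr rfl fun p hp => hcard p (hS.1 hp), Finset.prod_const]
    have h3 := abs_card_filter_range_mod_sub_le N _ hd R (Finset.filter_subset _ _)
    have h4 : (Finset.range N).filter (fun x => x % (∏ p ∈ S, p) ∈ R) =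
        (Finset.range N).filter (fun m => ∀ p ∈ S, m % p ∈ Ω p) := by
      refine Finset.filter_congr fun m _ => ?_
      rw [hR, Finset.mem_filter, Finset.mem_range]
      constructor
      · rintro ⟨-, h5⟩ p hp
        have := h5 p hp
        rwa [Nat.mod_mod_of_dvd _ (Finset.dvd_prod_of_mem _ hp)] at this
      · intro h5
        refine ⟨Nat.mod_lt _ hd, fun p hp => ?_⟩
        rw [Nat.mod_mod_of_dvd _ (Finset.dvd_prod_of_mem _ hp)]
        exact h5 p hp
    rw [h4, hRc] at h3
    rw [← Finset.mul_sum, Finset.sum_boole]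
    have h5 : ((2 ^ S.card : ℕ) : ℝ) / ((∏ p ∈ S, p : ℕ) : ℝ) = ∏ p ∈ S, (2 : ℝ) / p := by
      rw [Finset.prod_div_distrib, Finset.prod_const]
      push_cast
      rfl
    rw [h5] at h3
    push_cast at h3
    rw [abs_le] at h3
    rcases neg_one_pow_eq_or ℝ S.card with h | h <;> rw [h] <;> linarith
  refine (h1.trans (Finset.sum_le_sum h2)).trans ?_
  rw [Finset.sum_add_distrib, ← Finset.mul_sum]
  gcongr
  · refine truncated_sum_prod_le P (fun p => (2 : ℝ) / p) (fun p hp => ⟨by positivity, ?_⟩) h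
    have : (2 : ℝ) ≤ p := by exact_mod_cast (hP p hp).two_le
    rw [div_le_one (by linarith)]
    exact this
  · exact sum_powerset_two_pow_le P h

/-- The discriminant of `a x ^ 2 + b x + c` is a nonzero square modulo `p`,
and `p` does not divide `2 a (b ^ 2 - 4 a c)`. -/
def IsSplitPrime (a b c : ℤ) (p : ℕ) : Prop :=
  p.Prime ∧ ¬ ((p : ℤ) ∣ 2 * a * (b ^ 2 - 4 * a * c)) ∧
    ∃ t : ℤ, ¬ ((p : ℤ) ∣ t) ∧ (p : ℤ) ∣ (b ^ 2 - 4 * a * c - t ^ 2)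

/-- The residues modulo `d` at which `a x ^ 2 + b x + c` vanishes. -/
noncomputable def rootsMod (a b c : ℤ) (d : ℕ) : Finset ℕ :=
  (Finset.range d).filter (fun n => (d : ℤ) ∣ a * (n : ℤ) ^ 2 + b * (n : ℤ) + c)

/-- The local bound for the number of roots modulo powers of `p`, away from the part of the modulus
shared with `2 a (b ^ 2 - 4 a c)`. -/
noncomputable def rootWeight (a b c : ℤ) (p : ℕ) : ℕ :=
  if IsSplitPrime a b c p ∨ p ∣ (2 * a * (b ^ 2 - 4 * a * c)).natAbs then 2 else 0

lemma dvd_quadratic_iff_of_modEq {a b c : ℤ} {d m n : ℕ} (h : m ≡ n [MOD d]) :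
    (d : ℤ) ∣ a * (m : ℤ) ^ 2 + b * (m : ℤ) + c ↔ (d : ℤ) ∣ a * (n : ℤ) ^ 2 + b * (n : ℤ) + c := by
  have h1 : (m : ℤ) ≡ n [ZMOD d] := (Int.natCast_modEq_iff).mpr h
  exact (((h1.pow 2).mul_left a).add (h1.mul_left b)).add_right c |>.dvd_iff

lemma card_rootsMod_mul_le (a b c : ℤ) {m n : ℕ} (hmn : m.Coprime n) (hm : 0 < m) (hn : 0 < n) :
    (rootsMod a b c (m * n)).card ≤ (rootsMod a b c m).card * (rootsMod a b c n).card := by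
  rw [← card_filter_range_mul_of_coprime hmn hm hn (A := rootsMod a b c m) (B := rootsMod a b c n)
    (Finset.filter_subset _ _) (Finset.filter_subset _ _)]
  refine Finset.card_le_card fun x hx => ?_
  simp only [rootsMod, Finset.mem_filter, Finset.mem_range] at hx ⊢
  refine ⟨hx.1, ⟨Nat.mod_lt _ hm, ?_⟩, Nat.mod_lt _ hn, ?_⟩
  · rw [dvd_quadratic_iff_of_modEq (Nat.mod_modEq x m)]
    exact (Int.natCast_dvd_natCast.mpr (Nat.dvd_mul_right m n)).trans hx.2
  · rw [dvd_quadratic_iff_of_modEq (Nat.mod_modEq x n)]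
    exact (Int.natCast_dvd_natCast.mpr (Nat.dvd_mul_left n m)).trans hx.2

lemma card_le_of_pairwise_modEq {q m : ℕ} {S : Finset ℕ} (hS : S ⊆ Finset.range (q * m))
    (h : ∀ x ∈ S, ∀ y ∈ S, x ≡ y [MOD q]) : S.card ≤ m := by
  have : S.card ≤ (Finset.range m).card := by
    refine Finset.card_le_card_of_injOn (fun x => x / q) (fun x hx => ?_) fun x hx y hy hxy => ?_
    · exact Finset.mem_coe.mpr (Finset.mem_range.mpr
        (Nat.div_lt_of_lt_mul (Finset.mem_range.mp (hS hx))))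
    · have h1 : x % q = y % q := h x hx y hy
      have h2 : x / q = y / q := hxy
      rw [← Nat.div_add_mod x q, ← Nat.div_add_mod y q, h1, h2]
  simpa using this

lemma pow_sub_dvd_of_dvd_mul {p u v : ℤ} (hp : Prime p) {k s : ℕ} (h : p ^ k ∣ u * v)
    (hv : ¬ p ^ (s + 1) ∣ v) (hs : s ≤ k) : p ^ (k - s) ∣ u := by
  have hv0 : v ≠ 0 := by rintro rfl; exact hv (dvd_zero _)
  obtain ⟨v', hvv, hv'⟩ := (FiniteMultiplicity.of_prime_left hp hv0).exists_eq_pow_mul_and_not_dvd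
  set i := multiplicity p v
  have hi : i ≤ s := by
    by_contra hcon
    exact hv ((pow_dvd_pow p (by omega)).trans (Dvd.intro _ hvv.symm))
  rw [hvv, ← mul_assoc] at h
  have h1 := hp.pow_dvd_of_dvd_mul_right k hv' h
  have h2 : p ^ k = p ^ (k - i) * p ^ i := by rw [← pow_add]; congr 1; omega
  rw [h2] at h1
  exact (pow_dvd_pow p (by omega)).trans
    (Int.dvd_of_mul_dvd_mul_right (pow_ne_zero _ hp.ne_zero) h1)

lemma card_rootsMod_prime_pow_le {a b c : ℤ} {p : ℕ} (hp : p.Prime) {E : ℕ} (hE : E ≠ 0)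
    (haE : a * (b ^ 2 - 4 * a * c) ∣ (E : ℤ)) (k : ℕ) :
    (rootsMod a b c (p ^ k)).card ≤ 2 * p ^ E.factorization p := by
  have hpZ : Prime (p : ℤ) := Nat.prime_iff_prime_int.mp hp
  have ha : a ≠ 0 := by
    rintro rfl
    rw [zero_mul, zero_dvd_iff] at haE
    exact hE (by exact_mod_cast haE)
  have hD : b ^ 2 - 4 * a * c ≠ 0 := by
    intro h
    rw [h, mul_zero, zero_dvd_iff] at haE
    exact hE (by exact_mod_cast haE)
  obtain ⟨a', haa, ha'⟩ := (FiniteMultiplicity.of_prime_left hpZ ha).exists_eq_pow_mul_and_not_dvd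
  obtain ⟨D', hDD, hD'⟩ := (FiniteMultiplicity.of_prime_left hpZ hD).exists_eq_pow_mul_and_not_dvd
  set α := multiplicity (p : ℤ) a
  set s := multiplicity (p : ℤ) (b ^ 2 - 4 * a * c)
  have hαs : α + s ≤ E.factorization p := by
    rw [← hp.pow_dvd_iff_le_factorization hE]
    have : ((p ^ (α + s) : ℕ) : ℤ) ∣ (E : ℤ) := by
      refine dvd_trans ?_ haE
      push_cast
      rw [pow_add]
      exact mul_dvd_mul (Dvd.intro _ haa.symm) (Dvd.intro _ hDD.symm)
    exact_mod_cast this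
  have hpow : p ^ (α + s) ≤ p ^ E.factorization p := Nat.pow_le_pow_right hp.pos hαs
  rcases le_or_gt k (α + s) with hk | hk
  · calc (rootsMod a b c (p ^ k)).card ≤ (Finset.range (p ^ k)).card :=
          Finset.card_le_card (Finset.filter_subset _ _)
      _ = p ^ k := Finset.card_range _
      _ ≤ p ^ (α + s) := Nat.pow_le_pow_right hp.pos hk
      _ ≤ 2 * p ^ E.factorization p := by omega
  have hDs : ¬ (p : ℤ) ^ (s + 1) ∣ b ^ 2 - 4 * a * c := by
    rw [hDD, pow_succ]
    intro h
    exact hD' (Int.dvd_of_mul_dvd_mul_left (pow_ne_zero _ hpZ.ne_zero) h)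
  rcases (rootsMod a b c (p ^ k)).eq_empty_or_nonempty with h0 | ⟨n₀, hn₀⟩
  · simp [h0]
  set S := rootsMod a b c (p ^ k) with hS
  have hsplit : p ^ k = p ^ (k - s - α) * p ^ (α + s) := by
    rw [← pow_add]; congr 1; omega
  have hroot : ∀ n ∈ S, (p : ℤ) ^ k ∣ a * (n : ℤ) ^ 2 + b * n + c := by
    intro n hn
    have := (Finset.mem_filter.mp hn).2
    exact_mod_cast this
  have hSr : S ⊆ Finset.range (p ^ (k - s - α) * p ^ (α + s)) := by
    rw [← hsplit]; exact Finset.filter_subset _ _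
  have hmod : ∀ x y : ℕ, (p : ℤ) ^ (k - s - α) ∣ x - y → x ≡ y [MOD p ^ (k - s - α)] := by
    intro x y h
    rw [← Int.natCast_modEq_iff]
    refine (Int.modEq_iff_dvd.mpr ?_).symm
    exact_mod_cast h
  set S₁ := S.filter (fun n : ℕ => (p : ℤ) ^ (k - s) ∣ (n : ℤ) - n₀) with hS₁
  set S₂ := S.filter (fun n : ℕ => ¬ (p : ℤ) ^ (k - s) ∣ (n : ℤ) - n₀) with hS₂
  have h1 : S₁.card ≤ p ^ (α + s) := by
    refine card_le_of_pairwise_modEq ((Finset.filter_subset _ _).trans hSr) fun x hx y hy => ?_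
    apply hmod
    have h2 := dvd_sub (Finset.mem_filter.mp hx).2 (Finset.mem_filter.mp hy).2
    rw [sub_sub_sub_cancel_right] at h2
    exact (pow_dvd_pow _ (by omega)).trans h2
  have h2 : S₂.card ≤ p ^ (α + s) := by
    have hlin : ∀ n ∈ S₂, (p : ℤ) ^ (k - s) ∣ a * (n + n₀) + b := by
      intro n hn
      rw [hS₂, Finset.mem_filter] at hn
      have h3 : (p : ℤ) ^ k ∣ (n - n₀) * (a * (n + n₀) + b) := by
        have e : ((n : ℤ) - n₀) * (a * (n + n₀) + b) =
            (a * (n : ℤ) ^ 2 + b * n + c) - (a * (n₀ : ℤ) ^ 2 + b * n₀ + c) := by ring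
        rw [e]
        exact dvd_sub (hroot n hn.1) (hroot n₀ hn₀)
      by_contra hcon
      by_cases hu : (p : ℤ) ^ (s + 1) ∣ (n : ℤ) - n₀
      · by_cases hv : (p : ℤ) ^ (s + 1) ∣ a * (n + n₀) + b
        · apply hDs
          have h4 : (p : ℤ) ^ (s + 1) ∣ 2 * a * n₀ + b := by
            have e : 2 * a * n₀ + b = (a * (n + n₀) + b) - a * ((n : ℤ) - n₀) := by ring
            rw [e]
            exact dvd_sub hv (hu.mul_left a)
          have h5 : (p : ℤ) ^ (s + 1) ∣ a * (n₀ : ℤ) ^ 2 + b * n₀ + c :=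
            (pow_dvd_pow _ (by omega)).trans (hroot n₀ hn₀)
          have e : b ^ 2 - 4 * a * c = (2 * a * n₀ + b) * (2 * a * n₀ + b) -
              4 * a * (a * (n₀ : ℤ) ^ 2 + b * n₀ + c) := by ring
          rw [e]
          exact dvd_sub (h4.mul_left (2 * a * n₀ + b)) (h5.mul_left (4 * a))
        · exact hn.2 (pow_sub_dvd_of_dvd_mul hpZ h3 hv (by omega))
      · rw [mul_comm] at h3
        exact hcon (pow_sub_dvd_of_dvd_mul hpZ h3 hu (by omega))
    refine card_le_of_pairwise_modEq ((Finset.filter_subset _ _).trans hSr) fun x hx y hy => ?_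
    apply hmod
    have h3 : (p : ℤ) ^ (k - s) ∣ (x - y) * a := by
      have e : ((x : ℤ) - y) * a = (a * (x + n₀) + b) - (a * (y + n₀) + b) := by ring
      rw [e]
      exact dvd_sub (hlin x hx) (hlin y hy)
    refine pow_sub_dvd_of_dvd_mul hpZ h3 ?_ (by omega)
    rw [haa, pow_succ]
    exact fun h => ha' (Int.dvd_of_mul_dvd_mul_left (pow_ne_zero _ hpZ.ne_zero) h)
  have h3 : S ⊆ S₁ ∪ S₂ := by
    intro n hn
    rw [Finset.mem_union, hS₁, hS₂, Finset.mem_filter, Finset.mem_filter]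
    tauto
  have h4 := (Finset.card_le_card h3).trans (Finset.card_union_le _ _)
  omega

lemma rootsMod_prime_pow_eq_empty {a b c : ℤ} {p : ℕ} (hp : p.Prime)
    (hpE : ¬ (p : ℤ) ∣ 2 * a * (b ^ 2 - 4 * a * c)) (hns : ¬ IsSplitPrime a b c p)
    {k : ℕ} (hk : 0 < k) : rootsMod a b c (p ^ k) = ∅ := by
  rw [Finset.eq_empty_iff_forall_notMem]
  intro n hn
  have h1 := (Finset.mem_filter.mp hn).2
  have h2 : (p : ℤ) ∣ a * (n : ℤ) ^ 2 + b * n + c :=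
    (Int.natCast_dvd_natCast.mpr (dvd_pow_self p hk.ne')).trans h1
  have h3 : (p : ℤ) ∣ b ^ 2 - 4 * a * c - (2 * a * n + b) ^ 2 := by
    have e : b ^ 2 - 4 * a * c - (2 * a * n + b) ^ 2 =
        -(4 * a) * (a * (n : ℤ) ^ 2 + b * n + c) := by ring
    rw [e]
    exact h2.mul_left _
  refine hns ⟨hp, hpE, 2 * a * n + b, fun h4 => hpE (Dvd.dvd.mul_left ?_ (2 * a)), h3⟩
  have e : b ^ 2 - 4 * a * c =
      (b ^ 2 - 4 * a * c - (2 * a * n + b) ^ 2) + (2 * a * n + b) * (2 * a * n + b) := by ring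
  rw [e]
  exact dvd_add h3 (h4.mul_left _)

lemma card_rootsMod_le {a b c : ℤ} (hE : 2 * a * (b ^ 2 - 4 * a * c) ≠ 0) {d : ℕ} (hd : d ≠ 0) :
    (rootsMod a b c d).card ≤
      (2 * a * (b ^ 2 - 4 * a * c)).natAbs * ∏ p ∈ d.primeFactors, rootWeight a b c p := by
  set E := (2 * a * (b ^ 2 - 4 * a * c)).natAbs with hEdef
  have hE0 : E ≠ 0 := Int.natAbs_ne_zero.mpr hE
  have haE : a * (b ^ 2 - 4 * a * c) ∣ (E : ℤ) := by
    rw [hEdef, Int.dvd_natAbs]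
    exact ⟨2, by ring⟩
  have key : (rootsMod a b c d).card ≤
      ∏ p ∈ d.primeFactors, (p ^ E.factorization p * rootWeight a b c p) := by
    induction d using Nat.recOnPosPrimePosCoprime with
    | prime_pow p n hp hn =>
      rw [Nat.primeFactors_prime_pow hn.ne' hp, Finset.prod_singleton]
      unfold rootWeight
      split_ifs with h
      · rw [mul_comm]
        exact card_rootsMod_prime_pow_le hp hE0 haE n
      · rw [not_or] at h
        rw [rootsMod_prime_pow_eq_empty hp ?_ h.1 hn]
        · simp
        · intro h2
          exact h.2 (Int.natCast_dvd.mp h2)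
    | zero => exact absurd rfl hd
    | one => simp [rootsMod]
    | coprime m n hm hn hmn ihm ihn =>
      rw [hmn.primeFactors_mul, Finset.prod_union hmn.disjoint_primeFactors]
      exact (card_rootsMod_mul_le a b c hmn (by omega) (by omega)).trans
        (Nat.mul_le_mul (ihm (by omega)) (ihn (by omega)))
  refine key.trans ?_
  rw [Finset.prod_mul_distrib]
  refine Nat.mul_le_mul_right _ ?_
  calc ∏ p ∈ d.primeFactors, p ^ E.factorization p
      ≤ ∏ p ∈ d.primeFactors ∪ E.primeFactors, p ^ E.factorization p := by
        refine Finset.prod_le_prod_of_subset_of_one_le' Finset.subset_union_left fun p hp _ => ?_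
        rcases Finset.mem_union.mp hp with h | h <;>
          exact Nat.one_le_pow _ _ (Nat.prime_of_mem_primeFactors h).pos
    _ = ∏ p ∈ E.primeFactors, p ^ E.factorization p := by
        symm
        refine Finset.prod_subset Finset.subset_union_right fun p _ hp => ?_
        rw [← Nat.support_factorization, Finsupp.notMem_support_iff] at hp
        rw [hp, pow_zero]
    _ = E := Nat.prod_factorization_pow_eq_self hE0

lemma exists_two_roots {a b c : ℤ} {p : ℕ} (hsp : IsSplitPrime a b c p) {u : ℕ}
    (hu : ¬ p ∣ u) (r : ℕ) :
    ∃ Ω : Finset ℕ, Ω ⊆ Finset.range p ∧ Ω.card = 2 ∧ ∀ m : ℕ, m % p ∈ Ω →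
      (p : ℤ) ∣ a * ((r + u * m : ℕ) : ℤ) ^ 2 + b * ((r + u * m : ℕ) : ℤ) + c := by
  obtain ⟨hp, hpE, t, hpt, hdt⟩ := hsp
  have : Fact p.Prime := ⟨hp⟩
  have h2 : (2 : ZMod p) ≠ 0 := by
    intro h
    have h3 : (p : ℤ) ∣ 2 := (ZMod.intCast_zmod_eq_zero_iff_dvd 2 p).mp (by exact_mod_cast h)
    exact hpE ((h3.mul_right a).mul_right _)
  have ha : (a : ZMod p) ≠ 0 := by
    intro h
    exact hpE ((Dvd.dvd.mul_left ((ZMod.intCast_zmod_eq_zero_iff_dvd _ _).mp h) _).mul_right _)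
  have hu' : (u : ZMod p) ≠ 0 := by
    rwa [Ne, ZMod.natCast_eq_zero_iff]
  have ht : (t : ZMod p) ≠ 0 := by
    rwa [Ne, ZMod.intCast_zmod_eq_zero_iff_dvd]
  have hD : (b : ZMod p) ^ 2 - 4 * a * c = t ^ 2 := by
    have := (ZMod.intCast_zmod_eq_zero_iff_dvd _ _).mpr hdt
    push_cast at this
    exact sub_eq_zero.mp this
  set x : ZMod p := (t - b - 2 * a * r) / (2 * a * u) with hx
  set y : ZMod p := (-t - b - 2 * a * r) / (2 * a * u) with hy
  have hxy : x ≠ y := by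
    intro h
    rw [hx, hy, div_left_inj' (mul_ne_zero (mul_ne_zero h2 ha) hu')] at h
    have : (2 : ZMod p) * t = 0 := by linear_combination h
    exact (mul_ne_zero h2 ht) this
  have hroot : ∀ z : ZMod p, 2 * a * (r + u * z) + b = t ∨ 2 * a * (r + u * z) + b = -t →
      (a : ZMod p) * (r + u * z) ^ 2 + b * (r + u * z) + c = 0 := by
    intro z hz
    have h4 : (4 : ZMod p) * a ≠ 0 := by
      have : (4 : ZMod p) = 2 * 2 := by norm_num
      rw [this]
      exact mul_ne_zero (mul_ne_zero h2 h2) ha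
    have h5 : (2 * a * (r + u * z) + b) ^ 2 = (t : ZMod p) ^ 2 := by
      rcases hz with h | h <;> rw [h]
      ring
    have : (4 * a : ZMod p) * ((a : ZMod p) * (r + u * z) ^ 2 + b * (r + u * z) + c) = 0 := by
      linear_combination h5 - hD
    exact (mul_eq_zero.mp this).resolve_left h4
  have hxr : 2 * a * (r + u * x) + b = (t : ZMod p) := by
    rw [hx]; field_simp; ring
  have hyr : 2 * a * (r + u * y) + b = -(t : ZMod p) := by
    rw [hy]; field_simp; ring
  refine ⟨{x.val, y.val}, ?_, ?_, ?_⟩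
  · intro n hn
    rw [Finset.mem_insert, Finset.mem_singleton] at hn
    rcases hn with rfl | rfl <;> exact Finset.mem_range.mpr (ZMod.val_lt _)
  · exact Finset.card_pair fun h => hxy (ZMod.val_injective p h)
  · intro m hm
    rw [Finset.mem_insert, Finset.mem_singleton, ← ZMod.val_natCast] at hm
    have hm' : (m : ZMod p) = x ∨ (m : ZMod p) = y :=
      hm.imp (fun h => ZMod.val_injective p h) (fun h => ZMod.val_injective p h)
    rw [← ZMod.intCast_zmod_eq_zero_iff_dvd]
    push_cast
    apply hroot
    rcases hm' with h | h
    · left; rw [h]; exact hxr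
    · right; rw [h]; exact hyr

/-- The primes up to `n` that split. -/
noncomputable def splitPrimes (a b c : ℤ) (n : ℕ) : Finset ℕ :=
  (Finset.Icc 1 n).filter (IsSplitPrime a b c)

lemma mem_splitPrimes {a b c : ℤ} {n p : ℕ} :
    p ∈ splitPrimes a b c n ↔ IsSplitPrime a b c p ∧ p ≤ n := by
  rw [splitPrimes, Finset.mem_filter, Finset.mem_Icc]
  exact ⟨fun h => ⟨h.2, h.1.2⟩, fun h => ⟨⟨h.1.1.one_le, h.2⟩, h.1⟩⟩

lemma card_sifted_le (a b c : ℤ) {d : ℕ} (hd : 0 < d) (X z h : ℕ) (hh : Even h) :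
    (((Finset.Icc 1 X).filter (fun n : ℕ => (d : ℤ) ∣ a * (n : ℤ) ^ 2 + b * (n : ℤ) + c ∧
      ∀ p, IsSplitPrime a b c p → p ≤ z → ¬ p ∣ d →
        ¬ (p : ℤ) ∣ a * (n : ℤ) ^ 2 + b * (n : ℤ) + c)).card : ℝ) ≤
      (rootsMod a b c d).card * (((X : ℝ) / d + 1) *
        (Real.exp (-∑ p ∈ splitPrimes a b c z with ¬ p ∣ d, (2 : ℝ) / p) + Real.exp (-h) *
          Real.exp (Real.exp 1 * ∑ p ∈ splitPrimes a b c z with ¬ p ∣ d, (2 : ℝ) / p)) +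
        (2 * z + 1) ^ h) := by
  set P := (splitPrimes a b c z).filter (fun p => ¬ p ∣ d) with hP
  have hPm : ∀ p ∈ P, IsSplitPrime a b c p ∧ p ≤ z ∧ ¬ p ∣ d := by
    intro p hp
    rw [hP, Finset.mem_filter, mem_splitPrimes] at hp
    tauto
  set s := (Finset.Icc 1 X).filter (fun n : ℕ => (d : ℤ) ∣ a * (n : ℤ) ^ 2 + b * (n : ℤ) + c ∧
      ∀ p, IsSplitPrime a b c p → p ≤ z → ¬ p ∣ d →
        ¬ (p : ℤ) ∣ a * (n : ℤ) ^ 2 + b * (n : ℤ) + c) with hs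
  have hmaps : ∀ n ∈ s, n % d ∈ rootsMod a b c d := by
    intro n hn
    rw [hs, Finset.mem_filter] at hn
    rw [rootsMod, Finset.mem_filter, Finset.mem_range]
    exact ⟨Nat.mod_lt _ hd, (dvd_quadratic_iff_of_modEq (Nat.mod_modEq n d)).mpr hn.2.1⟩
  rw [Finset.card_eq_sum_card_fiberwise (f := fun n => n % d) (t := rootsMod a b c d) hmaps]
  push_cast
  rw [← nsmul_eq_mul]
  refine Finset.sum_le_card_nsmul _ _ _ fun r _ => ?_
  have hex : ∀ p : ℕ, ∃ Ω : Finset ℕ, p ∈ P → (Ω ⊆ Finset.range p ∧ Ω.card = 2 ∧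
      ∀ m : ℕ, m % p ∈ Ω →
        (p : ℤ) ∣ a * ((r + d * m : ℕ) : ℤ) ^ 2 + b * ((r + d * m : ℕ) : ℤ) + c) := by
    intro p
    by_cases hp : p ∈ P
    · obtain ⟨Ω, h1⟩ := exists_two_roots (hPm p hp).1 (hPm p hp).2.2 r
      exact ⟨Ω, fun _ => h1⟩
    · exact ⟨∅, fun h => absurd h hp⟩
  choose Ω hΩ using hex
  have hsieve := brun_pure_sieve (X / d + 1) h hh P (fun p hp => (hPm p hp).1.1) Ω
    (fun p hp => (hΩ p hp).1) (fun p hp => (hΩ p hp).2.1)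
  have hcard : (s.filter (fun n => n % d = r)).card ≤
      ((Finset.range (X / d + 1)).filter (fun m => ∀ p ∈ P, m % p ∉ Ω p)).card := by
    refine Finset.card_le_card_of_injOn (fun n => n / d) (fun n hn => ?_) ?_
    · rw [Finset.mem_coe, Finset.mem_filter, hs, Finset.mem_filter, Finset.mem_Icc] at hn
      obtain ⟨⟨⟨_, hnX⟩, _, hn2⟩, hr⟩ := hn
      rw [Finset.mem_coe, Finset.mem_filter, Finset.mem_range]
      refine ⟨Nat.lt_succ_of_le (Nat.div_le_div_right hnX), fun p hp hmem => ?_⟩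
      have h1 := (hΩ p hp).2.2 _ hmem
      rw [← hr, Nat.mod_add_div] at h1
      exact hn2 p (hPm p hp).1 (hPm p hp).2.1 (hPm p hp).2.2 h1
    · intro x hx y hy hxy
      have h1 := (Finset.mem_filter.mp (Finset.mem_coe.mp hx)).2
      have h2 := (Finset.mem_filter.mp (Finset.mem_coe.mp hy)).2
      have h3 : x / d = y / d := hxy
      rw [← Nat.div_add_mod x d, ← Nat.div_add_mod y d, h1, h2, h3]
  have hN : ((X / d + 1 : ℕ) : ℝ) ≤ (X : ℝ) / d + 1 := by
    push_cast
    have := @Nat.cast_div_le ℝ _ _ _ X d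
    linarith
  have hPz : (P.card : ℝ) ≤ z := by
    have : P.card ≤ z := by
      calc P.card ≤ (Finset.Icc 1 z).card :=
            Finset.card_le_card ((Finset.filter_subset _ _).trans (Finset.filter_subset _ _))
        _ = z := by simp
    exact_mod_cast this
  calc ((s.filter (fun n => n % d = r)).card : ℝ) ≤ _ := Nat.cast_le.mpr hcard
    _ ≤ _ := hsieve
    _ ≤ _ := by gcongr

lemma card_dvd_quadratic_le (a b c : ℤ) {d : ℕ} (hd : 0 < d) (X : ℕ) :
    (((Finset.Icc 1 X).filter
      (fun n : ℕ => (d : ℤ) ∣ a * (n : ℤ) ^ 2 + b * (n : ℤ) + c)).card : ℝ) ≤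
      (rootsMod a b c d).card * (2 * ((X : ℝ) / d) + 3) := by
  have h0 : splitPrimes a b c 0 = ∅ := by simp [splitPrimes]
  have h := card_sifted_le a b c hd X 0 0 (by decide)
  simp only [h0, Finset.filter_empty, Finset.sum_empty] at h
  refine le_trans ?_ (h.trans (le_of_eq ?_))
  · refine Nat.cast_le.mpr (Finset.card_le_card fun n hn => ?_)
    rw [Finset.mem_filter] at hn ⊢
    refine ⟨hn.1, hn.2, fun p hp hp0 => ?_⟩
    have := hp.1.pos
    omega
  · norm_num
    left
    ring

lemma exists_sum_inv_primes_le_log {η : ℝ} (hη : 0 < η) :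
    ∃ C : ℝ, 0 ≤ C ∧ ∀ n : ℕ, 1 ≤ n →
      ∑ p ∈ (Finset.Icc 1 n).filter Nat.Prime, (1 : ℝ) / p ≤ C + η * Real.log n := by
  obtain ⟨Y, hY⟩ := exists_nat_ge (Real.exp (2 / η))
  refine ⟨Y, by positivity, fun n hn => ?_⟩
  have hpt : ∀ p ∈ (Finset.Icc 1 n).filter Nat.Prime,
      (1 : ℝ) / p ≤ (if p ∈ Finset.Icc 1 Y then 1 else 0) + η / 2 * (Real.log p / p) := by
    intro p hp
    have hp' : p.Prime := (Finset.mem_filter.mp hp).2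
    have hp1 : (1 : ℝ) ≤ p := by exact_mod_cast hp'.one_le
    have hlog : 0 ≤ Real.log p := Real.log_nonneg hp1
    split_ifs with h
    · have h1 : (1 : ℝ) / p ≤ 1 := by rw [div_le_one (by linarith)]; exact hp1
      have h2 : 0 ≤ η / 2 * (Real.log p / p) := by positivity
      linarith
    · have h1 : Y < p := by
        by_contra hcon
        exact h (Finset.mem_Icc.mpr ⟨hp'.one_le, by omega⟩)
      have h2 : Real.exp (2 / η) ≤ p := hY.trans (by exact_mod_cast h1.le)
      have h3 : 2 / η ≤ Real.log p := (Real.le_log_iff_exp_le (by linarith)).mpr h2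
      have h4 : 1 ≤ η / 2 * Real.log p := by
        rw [div_le_iff₀ hη] at h3
        linarith
      rw [zero_add, ← mul_div_assoc]
      gcongr
  refine (Finset.sum_le_sum hpt).trans ?_
  rw [Finset.sum_add_distrib, ← Finset.mul_sum]
  have h1 := sum_log_div_primes_le n hn
  have h2 : ∑ p ∈ (Finset.Icc 1 n).filter Nat.Prime,
      (if p ∈ Finset.Icc 1 Y then (1 : ℝ) else 0) ≤ Y := by
    rw [← Finset.sum_filter, Finset.sum_const, nsmul_eq_mul, mul_one]
    have : (((Finset.Icc 1 n).filter Nat.Prime).filter (fun p => p ∈ Finset.Icc 1 Y)).card ≤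
        (Finset.Icc 1 Y).card :=
      Finset.card_le_card fun p hp => (Finset.mem_filter.mp hp).2
    rw [Nat.card_Icc, Nat.add_sub_cancel] at this
    exact_mod_cast this
  have h3 : η / 2 * ∑ p ∈ (Finset.Icc 1 n).filter Nat.Prime, Real.log p / p ≤
      η / 2 * (2 * Real.log n) := by gcongr
  linarith

lemma sum_splitPrimes_nonneg (a b c : ℤ) (n : ℕ) : 0 ≤ ∑ p ∈ splitPrimes a b c n, (1 : ℝ) / p :=
  Finset.sum_nonneg fun _ _ => by positivity

lemma exists_exp_sum_splitPrimes_le {B θ : ℝ} (hB : 0 < B) (hθ : 0 < θ) :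
    ∃ C : ℝ, 0 < C ∧ ∀ (a b c : ℤ) (X : ℕ), 1 ≤ X →
      Real.exp (B * ∑ p ∈ splitPrimes a b c X, (1 : ℝ) / p) ≤ C * (X : ℝ) ^ θ := by
  obtain ⟨C, hC, h⟩ := exists_sum_inv_primes_le_log (η := θ / B) (by positivity)
  refine ⟨Real.exp (B * C), Real.exp_pos _, fun a b c X hX => ?_⟩
  have hX0 : (0 : ℝ) < X := by exact_mod_cast hX
  rw [Real.rpow_def_of_pos hX0, ← Real.exp_add]
  gcongr
  have h1 : ∑ p ∈ splitPrimes a b c X, (1 : ℝ) / p ≤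
      ∑ p ∈ (Finset.Icc 1 X).filter Nat.Prime, (1 : ℝ) / p := by
    refine Finset.sum_le_sum_of_subset_of_nonneg (fun p hp => ?_) fun _ _ _ => by positivity
    rw [splitPrimes, Finset.mem_filter] at hp
    exact Finset.mem_filter.mpr ⟨hp.1, hp.2.1⟩
  calc B * ∑ p ∈ splitPrimes a b c X, (1 : ℝ) / p ≤ B * (C + θ / B * Real.log X) := by
        gcongr
        exact h1.trans (h X hX)
    _ = B * C + Real.log X * θ := by field_simp

lemma exists_two_pow_near {T : ℝ} (hT : 0 ≤ T) :
    ∃ k : ℕ, 1 ≤ k ∧ 8 * T ≤ 2 ^ k ∧ (2 : ℝ) ^ k ≤ 16 * T + 2 := by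
  obtain ⟨n, h1, h2⟩ := exists_nat_pow_near (le_max_right (8 * T) 1) (one_lt_two (α := ℝ))
  refine ⟨n + 1, by omega, (le_max_left _ _).trans h2.le, ?_⟩
  have : max (8 * T) 1 ≤ 8 * T + 1 := max_le (by linarith) (by linarith)
  rw [pow_succ]
  linarith

lemma exists_pow_le_exp (n : ℕ) {ε : ℝ} (hε : 0 < ε) :
    ∃ C : ℝ, 0 < C ∧ ∀ T : ℝ, 0 ≤ T → (16 * T + 2) ^ n ≤ C * Real.exp (ε * T) := by
  have hc : 0 < ε / 16 := by positivity
  refine ⟨n.factorial / (ε / 16) ^ n * Real.exp (ε / 8), by positivity, fun T hT => ?_⟩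
  have h1 : (ε / 16 * (16 * T + 2)) ^ n / n.factorial ≤ Real.exp (ε / 16 * (16 * T + 2)) :=
    Real.pow_div_factorial_le_exp _ (by positivity) n
  have h2 : Real.exp (ε / 16 * (16 * T + 2)) = Real.exp (ε / 8) * Real.exp (ε * T) := by
    rw [← Real.exp_add]
    congr 1
    ring
  rw [h2, div_le_iff₀ (by positivity), mul_pow] at h1
  rw [mul_assoc, div_mul_eq_mul_div, le_div_iff₀ (by positivity)]
  linarith

lemma exists_card_sifted_le {ε : ℝ} (hε : 0 < ε) :
    ∃ C : ℝ, 0 < C ∧ ∀ (a b c : ℤ) (X d y : ℕ), 2 ≤ X → 0 < d → (d : ℝ) ^ 4 ≤ X → y ≤ X →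
    (((Finset.Icc 1 X).filter (fun n : ℕ => (d : ℤ) ∣ a * (n : ℤ) ^ 2 + b * (n : ℤ) + c ∧
      ∀ p, IsSplitPrime a b c p → p ≤ y → ¬ p ∣ d →
        ¬ (p : ℤ) ∣ a * (n : ℤ) ^ 2 + b * (n : ℤ) + c)).card : ℝ) ≤
      C * Real.exp (ε * ∑ p ∈ splitPrimes a b c X, (1 : ℝ) / p) * ((X : ℝ) / d) *
        (rootsMod a b c d).card *
        Real.exp (-(2 * ∑ p ∈ splitPrimes a b c y with ¬ p ∣ d, (1 : ℝ) / p)) := by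
  obtain ⟨C₁, hC₁, hexp⟩ := exists_exp_sum_splitPrimes_le (B := 20) (θ := 1 / 2)
    (by norm_num) (by norm_num)
  obtain ⟨C₂, hC₂, hpow⟩ := exists_pow_le_exp 12 hε
  refine ⟨4 * Real.exp 16 * C₂ + Real.exp 3 * C₁, by positivity, ?_⟩
  intro a b c X d y hX hd hdX hyX
  set T := ∑ p ∈ splitPrimes a b c X, (1 : ℝ) / p with hT
  have hT0 : 0 ≤ T := sum_splitPrimes_nonneg a b c X
  obtain ⟨k, hk1, hk8, hk16⟩ := exists_two_pow_near hT0
  set h : ℕ := 2 ^ k with hh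
  have hhR : (h : ℝ) = 2 ^ k := by rw [hh]; push_cast; rfl
  have hX0 : (0 : ℝ) < X := by positivity
  have hX1 : (1 : ℝ) < X := by exact_mod_cast hX
  set w : ℝ := (X : ℝ) ^ ((1 : ℝ) / 2 ^ (k + 2)) with hw
  have hw1 : 1 < w := Real.one_lt_rpow hX1 (by positivity)
  have hwX : (X : ℝ) = w ^ (2 ^ (k + 2)) := by
    rw [hw, ← Real.rpow_natCast, ← Real.rpow_mul hX0.le]
    push_cast
    rw [one_div, inv_mul_cancel₀ (by positivity), Real.rpow_one]
  set z : ℕ := min y ⌊w⌋₊ with hz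
  have hzw : (z : ℝ) ≤ w := by
    calc (z : ℝ) ≤ (⌊w⌋₊ : ℝ) := by exact_mod_cast min_le_right _ _
      _ ≤ w := Nat.floor_le (by linarith)
  have hdR : (0 : ℝ) < d := by exact_mod_cast hd
  have hd1 : (1 : ℝ) ≤ d := by exact_mod_cast hd
  set U := ∑ p ∈ splitPrimes a b c y with ¬ p ∣ d, (1 : ℝ) / p with hU
  set V := ∑ p ∈ splitPrimes a b c z with ¬ p ∣ d, (1 : ℝ) / p with hV
  have hV0 : 0 ≤ V := Finset.sum_nonneg fun _ _ => by positivity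
  have hVT : V ≤ T := by
    refine Finset.sum_le_sum_of_subset_of_nonneg (fun p hp => ?_) fun _ _ _ => by positivity
    rw [Finset.mem_filter, mem_splitPrimes] at hp
    rw [mem_splitPrimes]
    exact ⟨hp.1.1, hp.1.2.trans ((min_le_left _ _).trans hyX)⟩
  have hUT : U ≤ T := by
    refine Finset.sum_le_sum_of_subset_of_nonneg (fun p hp => ?_) fun _ _ _ => by positivity
    rw [Finset.mem_filter, mem_splitPrimes] at hp
    rw [mem_splitPrimes]
    exact ⟨hp.1.1, hp.1.2.trans hyX⟩
  have hUV : U ≤ V + 4 * ((k : ℝ) + 2) := by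
    have h1 := sum_inv_primes_le hw1 (k + 2) X hwX.le
    push_cast at h1
    refine le_trans ?_ (add_le_add_right h1 V)
    rw [hU, hV]
    refine le_trans (Finset.sum_le_sum_of_subset_of_nonneg
      (t := (splitPrimes a b c z).filter (fun p => ¬ p ∣ d) ∪
        (Finset.Icc 1 X).filter (fun p : ℕ => p.Prime ∧ w < p)) ?_ fun _ _ _ => by positivity) ?_
    · intro p hp
      rw [Finset.mem_filter, mem_splitPrimes] at hp
      rw [Finset.mem_union, Finset.mem_filter, mem_splitPrimes, Finset.mem_filter, Finset.mem_Icc]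
      by_cases hpw : w < p
      · exact Or.inr ⟨⟨hp.1.1.1.one_le, hp.1.2.trans hyX⟩, hp.1.1.1, hpw⟩
      · exact Or.inl ⟨⟨hp.1.1, le_min hp.1.2 (Nat.le_floor (not_lt.mp hpw))⟩, hp.2⟩
    · rw [← Finset.sum_union_inter]
      exact le_add_of_nonneg_right (Finset.sum_nonneg fun _ _ => by positivity)
  have hk12 : Real.exp (8 * ((k : ℝ) + 2)) ≤ Real.exp 16 * (C₂ * Real.exp (ε * T)) := by
    have e : 8 * ((k : ℝ) + 2) = 16 + k * 8 := by ring
    rw [e, Real.exp_add, Real.exp_nat_mul]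
    gcongr
    have h8 : Real.exp 8 ≤ 2 ^ 12 := by
      have h1 : Real.exp 8 = Real.exp 1 ^ 8 := by rw [← Real.exp_nat_mul]; norm_num
      rw [h1]
      calc Real.exp 1 ^ 8 ≤ 2.7182818286 ^ 8 := by
            gcongr
            exact Real.exp_one_lt_d9.le
        _ ≤ 2 ^ 12 := by norm_num
    calc Real.exp 8 ^ k ≤ (2 ^ 12) ^ k := by gcongr
      _ = (2 ^ k) ^ 12 := by rw [← pow_mul, ← pow_mul, mul_comm]
      _ ≤ (16 * T + 2) ^ 12 := by gcongr
      _ ≤ _ := hpow T hT0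
  have hmain : Real.exp (-(2 * V)) ≤
      Real.exp 16 * C₂ * Real.exp (ε * T) * Real.exp (-(2 * U)) := by
    calc Real.exp (-(2 * V)) ≤ Real.exp (8 * ((k : ℝ) + 2) + -(2 * U)) := by
          gcongr
          linarith
      _ ≤ Real.exp 16 * (C₂ * Real.exp (ε * T)) * Real.exp (-(2 * U)) := by
          rw [Real.exp_add]
          gcongr
      _ = _ := by ring
  have hsecond : Real.exp (-h) * Real.exp (Real.exp 1 * (2 * V)) ≤ Real.exp (-(2 * V)) := by
    rw [← Real.exp_add]
    gcongr
    have h1 : Real.exp 1 * (2 * V) ≤ 3 * (2 * V) := by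
      gcongr
      exact (Real.exp_one_lt_d9.trans (by norm_num)).le
    rw [hhR]
    linarith
  have hXd : (1 : ℝ) ≤ X / d := by
    rw [le_div_iff₀ hdR, one_mul]
    exact le_trans (le_self_pow₀ hd1 (by norm_num)) hdX
  have hXd0 : (0 : ℝ) ≤ X / d := zero_le_one.trans hXd
  have hXd34 : (X : ℝ) ^ ((3 : ℝ) / 4) ≤ X / d := by
    rw [le_div_iff₀ hdR]
    have h1 : (d : ℝ) ≤ (X : ℝ) ^ ((1 : ℝ) / 4) := by
      calc (d : ℝ) = ((d : ℝ) ^ 4) ^ ((1 : ℝ) / 4) := by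
            rw [← Real.rpow_natCast, ← Real.rpow_mul hdR.le]; norm_num
        _ ≤ _ := by gcongr
    calc (X : ℝ) ^ ((3 : ℝ) / 4) * d ≤ (X : ℝ) ^ ((3 : ℝ) / 4) * (X : ℝ) ^ ((1 : ℝ) / 4) := by
          gcongr
      _ = X := by rw [← Real.rpow_add hX0]; norm_num
  have herr : (2 * (z : ℝ) + 1) ^ h ≤
      Real.exp 3 * C₁ * ((X : ℝ) / d) * Real.exp (-(2 * T)) := by
    have h1 : 2 * (z : ℝ) + 1 ≤ Real.exp (11 / 10) * w := by
      have : (3 : ℝ) ≤ Real.exp (11 / 10) := by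
        have h2 : Real.exp (11 / 10) = Real.exp 1 * Real.exp (1 / 10) := by
          rw [← Real.exp_add]; norm_num
        have h3 := Real.exp_one_gt_d9
        have h4 := Real.add_one_le_exp (1 / 10 : ℝ)
        have h5 := Real.quadratic_le_exp_of_nonneg (x := 1 / 10) (by norm_num)
        rw [h2]
        nlinarith
      nlinarith
    have h2 : w ^ h = (X : ℝ) ^ ((1 : ℝ) / 4) := by
      rw [hw, ← Real.rpow_natCast, ← Real.rpow_mul hX0.le, hhR, pow_add]
      congr 1
      field_simp
      norm_num
    have h3 : Real.exp (11 / 10) ^ h ≤ Real.exp 3 * Real.exp (20 * T) * Real.exp (-(2 * T)) := by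
      rw [← Real.exp_nat_mul, ← Real.exp_add, ← Real.exp_add, hhR]
      gcongr
      linarith
    calc (2 * (z : ℝ) + 1) ^ h ≤ (Real.exp (11 / 10) * w) ^ h := by gcongr
      _ = Real.exp (11 / 10) ^ h * (X : ℝ) ^ ((1 : ℝ) / 4) := by rw [mul_pow, h2]
      _ ≤ Real.exp 3 * (C₁ * (X : ℝ) ^ ((1 : ℝ) / 2)) * Real.exp (-(2 * T)) *
          (X : ℝ) ^ ((1 : ℝ) / 4) := by
          gcongr
          refine h3.trans ?_
          gcongr
          exact hexp a b c X (by omega)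
      _ = Real.exp 3 * C₁ * ((X : ℝ) ^ ((1 : ℝ) / 2) * (X : ℝ) ^ ((1 : ℝ) / 4)) *
          Real.exp (-(2 * T)) := by ring
      _ = Real.exp 3 * C₁ * (X : ℝ) ^ ((3 : ℝ) / 4) * Real.exp (-(2 * T)) := by
          rw [← Real.rpow_add hX0]; norm_num
      _ ≤ _ := by gcongr
  have hsum2 : ∑ p ∈ splitPrimes a b c z with ¬ p ∣ d, (2 : ℝ) / p = 2 * V := by
    rw [hV, Finset.mul_sum]
    exact Finset.sum_congr rfl fun _ _ => by ring
  have hsift := card_sifted_le a b c hd X z h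
    (by rw [hh]; exact (even_two).pow_of_ne_zero (by omega))
  rw [hsum2] at hsift
  calc _ ≤ (((Finset.Icc 1 X).filter
        (fun n : ℕ => (d : ℤ) ∣ a * (n : ℤ) ^ 2 + b * (n : ℤ) + c ∧
        ∀ p, IsSplitPrime a b c p → p ≤ z → ¬ p ∣ d →
        ¬ (p : ℤ) ∣ a * (n : ℤ) ^ 2 + b * (n : ℤ) + c)).card : ℝ) := by
        refine Nat.cast_le.mpr (Finset.card_le_card fun n hn => ?_)
        rw [Finset.mem_filter] at hn ⊢
        exact ⟨hn.1, hn.2.1, fun p hp hpz => hn.2.2 p hp (hpz.trans (min_le_left _ _))⟩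
    _ ≤ _ := hsift
    _ ≤ (rootsMod a b c d).card * ((X / d + X / d) *
        (Real.exp (-(2 * V)) + Real.exp (-(2 * V))) +
        Real.exp 3 * C₁ * ((X : ℝ) / d) * Real.exp (-(2 * T))) :=
        mul_le_mul_of_nonneg_left (add_le_add (mul_le_mul (add_le_add_right hXd _)
          (add_le_add_right hsecond _) (add_nonneg (Real.exp_nonneg _) (mul_nonneg
            (Real.exp_nonneg _) (Real.exp_nonneg _))) (add_nonneg hXd0 hXd0)) herr)
          (Nat.cast_nonneg _)
    _ ≤ (rootsMod a b c d).card * ((X / d + X / d) *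
        (Real.exp 16 * C₂ * Real.exp (ε * T) * Real.exp (-(2 * U)) +
          Real.exp 16 * C₂ * Real.exp (ε * T) * Real.exp (-(2 * U))) +
        Real.exp 3 * C₁ * ((X : ℝ) / d) * (Real.exp (ε * T) * Real.exp (-(2 * U)))) := by
        refine mul_le_mul_of_nonneg_left (add_le_add (mul_le_mul_of_nonneg_left
          (add_le_add hmain hmain) (add_nonneg hXd0 hXd0))
          (mul_le_mul_of_nonneg_left ?_ (mul_nonneg (mul_nonneg (Real.exp_nonneg _) hC₁.le)
            hXd0))) (Nat.cast_nonneg _)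
        rw [← Real.exp_add]
        have : 0 ≤ ε * T := by positivity
        exact Real.exp_le_exp.mpr (by linarith)
    _ = _ := by ring

/-- The largest divisor of `m` composed of primes less than `q`. -/
noncomputable def smoothPart (m q : ℕ) : ℕ :=
  ∏ p ∈ m.primeFactors with p < q, p ^ m.factorization p

lemma exists_smoothPart_mul_eq {m : ℕ} (hm : m ≠ 0) (q : ℕ) :
    ∃ r, smoothPart m q * r = m ∧ (∀ p, p.Prime → p ∣ smoothPart m q → p < q) ∧
      ∀ p, p.Prime → p ∣ r → q ≤ p := by
  refine ⟨∏ p ∈ m.primeFactors with ¬ p < q, p ^ m.factorization p, ?_, ?_, ?_⟩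
  · rw [smoothPart, Finset.prod_filter_mul_prod_filter_not]
    exact Nat.prod_factorization_pow_eq_self hm
  · intro p hp hpd
    obtain ⟨s, hs, hps⟩ := (Prime.dvd_finsetProd_iff hp.prime _).mp hpd
    rw [Finset.mem_filter] at hs
    rw [(Nat.prime_dvd_prime_iff_eq hp (Nat.prime_of_mem_primeFactors hs.1)).mp
      (hp.dvd_of_dvd_pow hps)]
    exact hs.2
  · intro p hp hpd
    obtain ⟨s, hs, hps⟩ := (Prime.dvd_finsetProd_iff hp.prime _).mp hpd
    rw [Finset.mem_filter] at hs
    rw [(Nat.prime_dvd_prime_iff_eq hp (Nat.prime_of_mem_primeFactors hs.1)).mp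
      (hp.dvd_of_dvd_pow hps)]
    exact not_lt.mp hs.2

lemma coprime_of_smooth_of_rough {d r q : ℕ} (hd : ∀ p, p.Prime → p ∣ d → p < q)
    (hr : ∀ p, p.Prime → p ∣ r → q ≤ p) : d.Coprime r :=
  Nat.coprime_of_dvd fun p hp h1 h2 => absurd (hd p hp h1) (not_lt.mpr (hr p hp h2))

lemma smoothPart_succ (m q : ℕ) :
    smoothPart m (q + 1) = smoothPart m q ∨
      (q.Prime ∧ q ∣ m ∧ smoothPart m (q + 1) = q ^ m.factorization q * smoothPart m q) := by
  by_cases hq : q ∈ m.primeFactors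
  · right
    refine ⟨Nat.prime_of_mem_primeFactors hq, Nat.dvd_of_mem_primeFactors hq, ?_⟩
    have : m.primeFactors.filter (fun p => p < q + 1) =
        insert q (m.primeFactors.filter (fun p => p < q)) := by
      ext p
      simp only [Finset.mem_filter, Finset.mem_insert]
      constructor
      · rintro ⟨h1, h2⟩
        rcases Nat.lt_succ_iff_lt_or_eq.mp h2 with h | h
        · exact Or.inr ⟨h1, h⟩
        · exact Or.inl h
      · rintro (rfl | ⟨h1, h2⟩)
        · exact ⟨hq, Nat.lt_succ_self _⟩
        · exact ⟨h1, by omega⟩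
    rw [smoothPart, this, Finset.prod_insert (by simp)]
    rfl
  · left
    rw [smoothPart, smoothPart]
    congr 1
    ext p
    simp only [Finset.mem_filter]
    refine and_congr_right fun h => ⟨fun h2 => ?_, fun h2 => by omega⟩
    have : p ≠ q := fun h3 => hq (h3 ▸ h)
    omega

lemma exists_square_of_prime_pow_gt {Y : ℝ} {p e : ℕ} (hp : p.Prime) (hpY : (p : ℝ) ≤ Y)
    (hpe : Y < (p : ℝ) ^ e) :
    ∃ k, 1 ≤ k ∧ 2 * k ≤ e ∧ ((p ^ k : ℕ) : ℝ) ≤ Y ∧ Y < ((p ^ k : ℕ) : ℝ) ^ 3 := by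
  have hp1 : (1 : ℝ) ≤ p := by exact_mod_cast hp.one_le
  have hex : ∃ n, Y < (p : ℝ) ^ n := ⟨e, hpe⟩
  set n := Nat.find hex with hn
  have h1 : Y < (p : ℝ) ^ n := Nat.find_spec hex
  have hne : n ≤ e := Nat.find_min' hex hpe
  have h2 : 2 ≤ n := by
    by_contra hcon
    have : (p : ℝ) ^ n ≤ (p : ℝ) ^ 1 := pow_le_pow_right₀ hp1 (by omega)
    rw [pow_one] at this
    linarith
  have h3 : (p : ℝ) ^ (n - 1) ≤ Y := not_lt.mp (Nat.find_min hex (m := n - 1) (by omega))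
  refine ⟨n / 2, by omega, by omega, ?_, ?_⟩
  · push_cast
    exact le_trans (pow_le_pow_right₀ hp1 (by omega)) h3
  · push_cast
    rw [← pow_mul]
    exact lt_of_lt_of_le h1 (pow_le_pow_right₀ hp1 (by omega))

lemma exists_square_or_factorization {m : ℕ} (hm : m ≠ 0) {W Y : ℝ} {L : ℕ} (hL : 1 ≤ L)
    (hLY : (L : ℝ) ≤ Y) (hYW : Y ^ L ≤ W) :
    (∃ p k, p.Prime ∧ 1 ≤ k ∧ (p ^ k) ^ 2 ∣ m ∧ ((p ^ k : ℕ) : ℝ) ≤ W ∧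
      Y < ((p ^ k : ℕ) : ℝ) ^ 3) ∨
    ∃ d r q : ℕ, d * r = m ∧ d.Coprime r ∧ (d : ℝ) ≤ W ^ 2 ∧ (∀ p, p.Prime → p ∣ d → p < q) ∧
      (∀ p, p.Prime → p ∣ r → q ≤ p) ∧ (W < q ∨ (W < d ∧ L < q)) := by
  have hL1 : (1 : ℝ) ≤ L := by exact_mod_cast hL
  have hY1 : 1 ≤ Y := hL1.trans hLY
  have hYW' : Y ≤ W := le_trans (le_self_pow₀ hY1 (by omega)) hYW
  have hW1 : 1 ≤ W := hY1.trans hYW'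
  have hbad : ∀ (p : ℕ) (Y' : ℝ), p.Prime → (p : ℝ) ≤ Y' → Y ≤ Y' → Y' ≤ W →
      Y' < (p : ℝ) ^ m.factorization p →
      ∃ p k, p.Prime ∧ 1 ≤ k ∧ (p ^ k) ^ 2 ∣ m ∧ ((p ^ k : ℕ) : ℝ) ≤ W ∧
      Y < ((p ^ k : ℕ) : ℝ) ^ 3 := by
    intro p Y' hp hpY hYY hYW hlt
    obtain ⟨k, hk1, hk2, hk3, hk4⟩ := exists_square_of_prime_pow_gt hp hpY hlt
    refine ⟨p, k, hp, hk1, ?_, hk3.trans hYW, lt_of_le_of_lt hYY hk4⟩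
    rw [← pow_mul, hp.pow_dvd_iff_le_factorization hm]
    omega
  rcases le_or_gt (m : ℝ) (W ^ 2) with hmW | hmW
  · right
    refine ⟨m, 1, m + 1 + ⌈W⌉₊, mul_one m, Nat.coprime_one_right m, hmW, ?_, ?_, Or.inl ?_⟩
    · intro p _ hpm
      have := Nat.le_of_dvd (Nat.pos_of_ne_zero hm) hpm
      omega
    · intro p hp hp1
      exact absurd (Nat.dvd_one.mp hp1) hp.one_lt.ne'
    · have := Nat.le_ceil W
      push_cast
      have h0 : (0 : ℝ) ≤ m := Nat.cast_nonneg m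
      linarith
  have hex : ∃ q, W ^ 2 < (smoothPart m q : ℝ) := by
    refine ⟨m + 1, ?_⟩
    have : smoothPart m (m + 1) = m := by
      rw [smoothPart, Finset.filter_true_of_mem]
      · exact Nat.prod_factorization_pow_eq_self hm
      · intro p hp
        exact Nat.lt_succ_of_le (Nat.le_of_mem_primeFactors hp)
    rwa [this]
  have hfind := Nat.find_spec hex
  have hmin := fun k => Nat.find_min hex (m := k)
  obtain ⟨q, hq⟩ : ∃ q, Nat.find hex = q + 1 := by
    refine Nat.exists_eq_succ_of_ne_zero fun h0 => ?_
    rw [h0] at hfind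
    have h1 : smoothPart m 0 = 1 := by simp [smoothPart]
    rw [h1] at hfind
    have : 1 ≤ W ^ 2 := one_le_pow₀ hW1
    push_cast at hfind
    linarith
  rw [hq] at hfind
  have hdZ : (smoothPart m q : ℝ) ≤ W ^ 2 := not_lt.mp (hmin q (by omega))
  rcases smoothPart_succ m q with h | ⟨hqp, hqm, hsucc⟩
  · rw [h] at hfind
    linarith
  obtain ⟨r, hr1, hr2, hr3⟩ := exists_smoothPart_mul_eq hm q
  rcases lt_or_ge W (q : ℝ) with hqW | hqW
  · exact Or.inr ⟨smoothPart m q, r, q, hr1, coprime_of_smooth_of_rough hr2 hr3, hdZ, hr2, hr3,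
      Or.inl hqW⟩
  rcases lt_or_ge W (smoothPart m q : ℝ) with hd | hd
  · rcases lt_or_ge L q with hqL | hqL
    · exact Or.inr ⟨smoothPart m q, r, q, hr1, coprime_of_smooth_of_rough hr2 hr3, hdZ, hr2, hr3,
      Or.inr ⟨hd, hqL⟩⟩
    · left
      by_contra hcon
      refine absurd hd (not_lt.mpr (le_trans ?_ hYW))
      have hle : ∀ p ∈ m.primeFactors.filter (fun p => p < q),
          (p : ℝ) ^ m.factorization p ≤ Y := by
        intro p hp
        rw [Finset.mem_filter] at hp
        by_contra hlt
        refine hcon (hbad p Y (Nat.prime_of_mem_primeFactors hp.1) ?_ le_rfl hYW' (not_le.mp hlt))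
        exact le_trans (by exact_mod_cast (hp.2.trans_le hqL).le) hLY
      rw [smoothPart]
      push_cast
      refine (Finset.prod_le_prod (fun _ _ => by positivity) hle).trans ?_
      rw [Finset.prod_const]
      refine pow_le_pow_right₀ hY1 ?_
      calc (m.primeFactors.filter (fun p => p < q)).card ≤ (Finset.range q).card :=
            Finset.card_le_card fun p hp => Finset.mem_range.mpr (Finset.mem_filter.mp hp).2
        _ ≤ L := by rw [Finset.card_range]; exact hqL
  · left
    refine hbad q W hqp hqW hYW' le_rfl ?_
    by_contra hcon
    rw [hsucc] at hfind
    push_cast at hfind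
    have : (q : ℝ) ^ m.factorization q * (smoothPart m q : ℝ) ≤ W * W := by
      gcongr
      exact not_lt.mp hcon
    rw [sq] at hfind
    linarith

/-- `m` is a smooth part `d` times a coprime rough part, relative to the scale `X ^ (1 / 2 ^ j)`. -/
def HasScaledFactorization (L X j m d : ℕ) : Prop :=
  ∃ r, d * r = m ∧ d.Coprime r ∧ (d : ℝ) ^ 4 ≤ X ∧
    (∀ p, p.Prime → p ∣ d → 4 * 2 ^ j * Real.log p ≤ Real.log X) ∧
    (∀ p, p.Prime → p ∣ r → Real.log X < 8 * 2 ^ j * Real.log p) ∧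
    (j = 0 ∨ ((X : ℝ) < (d : ℝ) ^ 8 ∧ 4 * 2 ^ j * Real.log L ≤ Real.log X))

lemma exists_square_or_hasScaledFactorization {m X : ℕ} (hm : m ≠ 0) {Y : ℝ}
    {L : ℕ} (hL : 2 ≤ L) (hLY : (L : ℝ) ≤ Y) (hYX : Y ^ (8 * L) ≤ X) :
    (∃ p k, p.Prime ∧ 1 ≤ k ∧ (p ^ k) ^ 2 ∣ m ∧ ((p ^ k : ℕ) : ℝ) ^ 8 ≤ X ∧
      Y < ((p ^ k : ℕ) : ℝ) ^ 3) ∨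
    ∃ j d, HasScaledFactorization L X j m d := by
  have hL1 : (2 : ℝ) ≤ L := by exact_mod_cast hL
  have hY1 : 1 < Y := by linarith
  have hX1 : (1 : ℝ) < X := (one_lt_pow₀ hY1 (by omega)).trans_le hYX
  have hX0 : (0 : ℝ) < X := by linarith
  set W : ℝ := (X : ℝ) ^ ((1 : ℝ) / 8) with hW
  have hW0 : 0 < W := Real.rpow_pos_of_pos hX0 _
  have hWX : W ^ 8 = X := by
    rw [hW, ← Real.rpow_natCast, ← Real.rpow_mul hX0.le]; norm_num
  have hlogW : 8 * Real.log W = Real.log X := by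
    rw [← hWX, Real.log_pow]; norm_num
  have hYW : Y ^ L ≤ W := by
    rw [← hWX, mul_comm, pow_mul] at hYX
    exact (pow_le_pow_iff_left₀ (by positivity) hW0.le (by norm_num)).mp hYX
  rcases exists_square_or_factorization hm (by omega) hLY hYW with
    ⟨p, k, hp, hk, h1, h2, h3⟩ | ⟨d, r, q, hdr, hcop, hdW, hdq, hrq, h⟩
  · left
    refine ⟨p, k, hp, hk, h1, ?_, h3⟩
    rw [← hWX]
    gcongr
  right
  have hd0 : d ≠ 0 := fun h0 => hm (by rw [← hdr, h0, zero_mul])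
  have hdpos : (0 : ℝ) < d := by exact_mod_cast Nat.pos_of_ne_zero hd0
  have hd4 : (d : ℝ) ^ 4 ≤ X := by
    rw [← hWX]
    calc (d : ℝ) ^ 4 ≤ (W ^ 2) ^ 4 := by gcongr
      _ = W ^ 8 := by rw [← pow_mul]
  rcases lt_or_ge W (q : ℝ) with hqW | hqW
  · refine ⟨0, d, r, hdr, hcop, hd4, ?_, ?_, Or.inl rfl⟩
    · intro p hp hpd
      have hp0 : (0 : ℝ) < p := by exact_mod_cast hp.pos
      have h1 : Real.log p ≤ Real.log d :=
        Real.log_le_log hp0 (by exact_mod_cast Nat.le_of_dvd (Nat.pos_of_ne_zero hd0) hpd)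
      have h2 := Real.log_le_log (by positivity) hd4
      rw [Real.log_pow] at h2
      push_cast at h2
      rw [pow_zero]
      linarith
    · intro p hp hpr
      have h1 : Real.log W < Real.log p :=
        Real.log_lt_log hW0 (hqW.trans_le (by exact_mod_cast hrq p hp hpr))
      rw [pow_zero]
      linarith
  obtain ⟨hWd, hLq⟩ := h.resolve_left (not_lt.mpr hqW)
  have hq0 : (0 : ℝ) < q := by exact_mod_cast (by omega : 0 < q)
  have hq1 : (1 : ℝ) < q := by exact_mod_cast (by omega : 1 < q)
  have hlq : 0 < Real.log q := Real.log_pos hq1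
  have hu : 2 ≤ Real.log X / (4 * Real.log q) := by
    rw [le_div_iff₀ (by positivity)]
    have := Real.log_le_log hq0 hqW
    linarith
  obtain ⟨j, hj1, hj2⟩ := exists_nat_pow_near (by linarith : 1 ≤ Real.log X / (4 * Real.log q))
    (one_lt_two (α := ℝ))
  rw [le_div_iff₀ (by positivity)] at hj1
  rw [div_lt_iff₀ (by positivity), pow_succ] at hj2
  refine ⟨j, d, r, hdr, hcop, hd4, ?_, ?_, Or.inr ⟨?_, ?_⟩⟩
  · intro p hp hpd
    have h1 : Real.log p ≤ Real.log q :=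
      Real.log_le_log (by exact_mod_cast hp.pos) (by exact_mod_cast (hdq p hp hpd).le)
    calc 4 * 2 ^ j * Real.log p ≤ 4 * 2 ^ j * Real.log q := by gcongr
      _ = 2 ^ j * (4 * Real.log q) := by ring
      _ ≤ _ := hj1
  · intro p hp hpr
    have h1 : Real.log q ≤ Real.log p := Real.log_le_log hq0 (by exact_mod_cast hrq p hp hpr)
    calc Real.log X < 2 ^ j * 2 * (4 * Real.log q) := hj2
      _ = 8 * 2 ^ j * Real.log q := by ring
      _ ≤ _ := by gcongr
  · rw [← hWX]
    gcongr
  · have h1 : Real.log L ≤ Real.log q :=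
      Real.log_le_log (by linarith) (by exact_mod_cast hLq.le)
    calc 4 * 2 ^ j * Real.log L ≤ 4 * 2 ^ j * Real.log q := by gcongr
      _ = 2 ^ j * (4 * Real.log q) := by ring
      _ ≤ _ := hj1

lemma card_rootsMod_prime_pow_sq_le {a b c : ℤ} (hE : 2 * a * (b ^ 2 - 4 * a * c) ≠ 0) {p k : ℕ}
    (hp : p.Prime) (hk : 1 ≤ k) :
    (rootsMod a b c ((p ^ k) ^ 2)).card ≤ 2 * (2 * a * (b ^ 2 - 4 * a * c)).natAbs := by
  refine (card_rootsMod_le hE (pow_ne_zero _ (pow_ne_zero _ hp.ne_zero))).trans ?_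
  rw [← pow_mul, Nat.primeFactors_prime_pow (by omega) hp, Finset.prod_singleton, mul_comm]
  refine Nat.mul_le_mul_right _ ?_
  unfold rootWeight
  split_ifs <;> omega

lemma card_dvd_by_large_square_le {a b c : ℤ} (hE : 2 * a * (b ^ 2 - 4 * a * c) ≠ 0) {U : ℝ}
    (hU : 0 < U) (X : ℕ) :
    (((Finset.Icc 1 X).filter (fun n : ℕ => ∃ p k : ℕ, p.Prime ∧ 1 ≤ k ∧
      (p ^ k) ^ 2 ∣ (a * (n : ℤ) ^ 2 + b * (n : ℤ) + c).natAbs ∧ (p ^ k) ^ 2 ≤ X ∧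
      U < ((p ^ k : ℕ) : ℝ))).card : ℝ) ≤
      20 * (2 * a * (b ^ 2 - 4 * a * c)).natAbs * X / U := by
  set E := (2 * a * (b ^ 2 - 4 * a * c)).natAbs with hEd
  set R := (Finset.Ioo ⌊U⌋₊ (X + 1)).filter
    (fun d => ∃ p k : ℕ, p.Prime ∧ 1 ≤ k ∧ d = p ^ k ∧ d ^ 2 ≤ X) with hR
  have hsub : (Finset.Icc 1 X).filter (fun n : ℕ => ∃ p k : ℕ, p.Prime ∧ 1 ≤ k ∧
      (p ^ k) ^ 2 ∣ (a * (n : ℤ) ^ 2 + b * (n : ℤ) + c).natAbs ∧ (p ^ k) ^ 2 ≤ X ∧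
      U < ((p ^ k : ℕ) : ℝ)) ⊆ R.biUnion (fun d => (Finset.Icc 1 X).filter
      (fun n : ℕ => ((d ^ 2 : ℕ) : ℤ) ∣ a * (n : ℤ) ^ 2 + b * (n : ℤ) + c)) := by
    intro n hn
    rw [Finset.mem_filter] at hn
    obtain ⟨hnX, p, k, hp, hk, hdvd, hle, hlt⟩ := hn
    rw [Finset.mem_biUnion]
    refine ⟨p ^ k, ?_, Finset.mem_filter.mpr ⟨hnX, Int.natCast_dvd.mpr hdvd⟩⟩
    rw [hR, Finset.mem_filter, Finset.mem_Ioo]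
    refine ⟨⟨(Nat.floor_lt hU.le).mpr hlt, ?_⟩, p, k, hp, hk, rfl, hle⟩
    have := Nat.le_self_pow (two_ne_zero) (p ^ k)
    omega
  have hterm : ∀ d ∈ R, (((Finset.Icc 1 X).filter
      (fun n : ℕ => ((d ^ 2 : ℕ) : ℤ) ∣ a * (n : ℤ) ^ 2 + b * (n : ℤ) + c)).card : ℝ) ≤
      10 * E * X * ((d : ℝ) ^ 2)⁻¹ := by
    intro d hd
    rw [hR, Finset.mem_filter] at hd
    obtain ⟨_, p, k, hp, hk, rfl, hle⟩ := hd
    have hpos : 0 < (p ^ k) ^ 2 := pow_pos (pow_pos hp.pos _) _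
    have hposR : (0 : ℝ) < ((p ^ k : ℕ) : ℝ) ^ 2 := by exact_mod_cast hpos
    refine (card_dvd_quadratic_le a b c hpos X).trans ?_
    have h1 : ((rootsMod a b c ((p ^ k) ^ 2)).card : ℝ) ≤ 2 * E := by
      exact_mod_cast card_rootsMod_prime_pow_sq_le hE hp hk
    have h2 : (1 : ℝ) ≤ X / (((p ^ k) ^ 2 : ℕ) : ℝ) := by
      rw [one_le_div (by exact_mod_cast hpos)]
      exact_mod_cast hle
    calc _ ≤ 2 * (E : ℝ) * (2 * ((X : ℝ) / (((p ^ k) ^ 2 : ℕ) : ℝ)) +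
          3 * ((X : ℝ) / (((p ^ k) ^ 2 : ℕ) : ℝ))) := by
          gcongr
          linarith
      _ = _ := by
          rw [Nat.cast_pow]
          ring
  calc _ ≤ (((R.biUnion (fun d => (Finset.Icc 1 X).filter
      (fun n : ℕ => ((d ^ 2 : ℕ) : ℤ) ∣ a * (n : ℤ) ^ 2 + b * (n : ℤ) + c))).card : ℕ) : ℝ) :=
        Nat.cast_le.mpr (Finset.card_le_card hsub)
    _ ≤ ∑ d ∈ R, (((Finset.Icc 1 X).filter
      (fun n : ℕ => ((d ^ 2 : ℕ) : ℤ) ∣ a * (n : ℤ) ^ 2 + b * (n : ℤ) + c)).card : ℝ) := by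
        exact_mod_cast Finset.card_biUnion_le
    _ ≤ ∑ d ∈ R, 10 * E * X * ((d : ℝ) ^ 2)⁻¹ := Finset.sum_le_sum hterm
    _ = 10 * E * X * ∑ d ∈ R, ((d : ℝ) ^ 2)⁻¹ := by rw [Finset.mul_sum]
    _ ≤ 10 * E * X * (2 / U) := by
        gcongr
        calc ∑ d ∈ R, ((d : ℝ) ^ 2)⁻¹ ≤ ∑ d ∈ Finset.Ioo ⌊U⌋₊ (X + 1), ((d : ℝ) ^ 2)⁻¹ :=
              Finset.sum_le_sum_of_subset_of_nonneg (Finset.filter_subset _ _)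
                fun _ _ _ => by positivity
          _ ≤ 2 / ((⌊U⌋₊ : ℝ) + 1) := sum_Ioo_inv_sq_le _ _
          _ ≤ 2 / U := by
              gcongr
              exact (Nat.lt_floor_add_one U).le
    _ = _ := by ring

lemma tsum_mul_pow_le {g : ℕ → ℝ} {r : ℝ} (hg0 : ∀ n, 0 ≤ g n) (hg : ∀ n, g n ≤ 6 * (n + 1))
    (hr0 : 0 ≤ r) (hr : r ≤ 3 / 5) :
    Summable (fun n => g n * r ^ n) ∧
      ∑' n, g n * r ^ n ≤ g 0 + g 1 * r + 68 * r ^ 2 := by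
  have hr1 : r < 1 := by linarith
  have hnorm : ‖r‖ < 1 := by rwa [Real.norm_of_nonneg hr0]
  have hs1 := hasSum_coe_mul_geometric_of_norm_lt_one hnorm
  have hs2 := hasSum_geometric_of_lt_one hr0 hr1
  have hsum : Summable (fun n => g n * r ^ n) := by
    refine Summable.of_nonneg_of_le (fun n => mul_nonneg (hg0 n) (pow_nonneg hr0 n))
      (fun n => mul_le_mul_of_nonneg_right (hg n) (pow_nonneg hr0 n)) ?_
    have := (hs1.add hs2).summable.mul_left 6
    refine this.congr fun n => ?_
    ring
  refine ⟨hsum, ?_⟩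
  have htail : HasSum (fun n : ℕ => 6 * r ^ 2 * ((n : ℝ) * r ^ n + 3 * r ^ n))
      (6 * r ^ 2 * (r / (1 - r) ^ 2 + 3 * (1 - r)⁻¹)) :=
    (hs1.add (hs2.mul_left 3)).mul_left _
  rw [← hsum.sum_add_tsum_nat_add 2, Finset.sum_range_succ, Finset.sum_range_one, pow_zero,
    pow_one, mul_one]
  gcongr
  have h1 : ∑' n, g (n + 2) * r ^ (n + 2) ≤ 6 * r ^ 2 * (r / (1 - r) ^ 2 + 3 * (1 - r)⁻¹) := by
    refine Summable.tsum_le_of_sum_range_le ?_ fun n => ?_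
    · exact (summable_nat_add_iff 2).mpr hsum
    · refine le_trans (Finset.sum_le_sum fun i _ => ?_)
        (htail.summable.sum_le_tsum (Finset.range n) fun i _ => by positivity) |>.trans_eq
          htail.tsum_eq
      have := mul_le_mul_of_nonneg_right (hg (i + 2)) (pow_nonneg hr0 (i + 2))
      refine this.trans (le_of_eq ?_)
      push_cast
      ring
  refine h1.trans ?_
  have h2 : (1 - r)⁻¹ ≤ 5 / 2 := by
    rw [inv_le_comm₀ (by linarith) (by norm_num)]
    linarith
  have h3 : r / (1 - r) ^ 2 ≤ 15 / 4 := by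
    rw [div_le_iff₀ (by nlinarith)]
    nlinarith
  nlinarith [sq_nonneg r]

/-- The multiplicative majorant of `f n * (rootsMod a b c n).card`, up to local corrections. -/
noncomputable def rootMajorant (a b c : ℤ) (f : ℕ → ℝ) (n : ℕ) : ℝ :=
  f n * ∏ p ∈ n.primeFactors, (rootWeight a b c p * Real.exp (2 / p))

lemma mul_card_rootsMod_mul_exp_le {a b c : ℤ} (hE : 2 * a * (b ^ 2 - 4 * a * c) ≠ 0) {f : ℕ → ℝ}
    {d : ℕ} (hd : d ≠ 0) (hf : 0 ≤ f d) (y : ℕ) :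
    f d * (rootsMod a b c d).card *
      Real.exp (2 * ∑ p ∈ splitPrimes a b c y with p ∣ d, (1 : ℝ) / p) ≤
      (2 * a * (b ^ 2 - 4 * a * c)).natAbs * rootMajorant a b c f d := by
  have h1 : ∑ p ∈ splitPrimes a b c y with p ∣ d, (1 : ℝ) / p ≤
      ∑ p ∈ d.primeFactors, (1 : ℝ) / p := by
    refine Finset.sum_le_sum_of_subset_of_nonneg (fun p hp => ?_) fun _ _ _ => by positivity
    rw [Finset.mem_filter, mem_splitPrimes] at hp
    exact Nat.mem_primeFactors.mpr ⟨hp.1.1.1, hp.2, hd⟩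
  have h2 : ((rootsMod a b c d).card : ℝ) ≤ (2 * a * (b ^ 2 - 4 * a * c)).natAbs *
      ∏ p ∈ d.primeFactors, (rootWeight a b c p : ℝ) := by
    exact_mod_cast card_rootsMod_le hE hd
  have h3 : Real.exp (2 * ∑ p ∈ splitPrimes a b c y with p ∣ d, (1 : ℝ) / p) ≤
      ∏ p ∈ d.primeFactors, Real.exp (2 / p) := by
    rw [← Real.exp_sum]
    refine Real.exp_le_exp.mpr ((mul_le_mul_of_nonneg_left h1 zero_le_two).trans_eq ?_)
    rw [Finset.mul_sum]
    exact Finset.sum_congr rfl fun _ _ => by ring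
  calc _ ≤ f d * ((2 * a * (b ^ 2 - 4 * a * c)).natAbs *
      ∏ p ∈ d.primeFactors, (rootWeight a b c p : ℝ)) *
        ∏ p ∈ d.primeFactors, Real.exp (2 / p) := by gcongr
    _ = _ := by
      rw [rootMajorant, Finset.prod_mul_distrib]
      ring

lemma rootWeight_le_two (a b c : ℤ) (p : ℕ) : rootWeight a b c p ≤ 2 := by
  unfold rootWeight
  split_ifs <;> omega

/-- The contribution of the prime `p` to the Euler product of `rootMajorant` at `1 - δ`. -/
noncomputable def localFactorBound (a b c : ℤ) (f : ℕ → ℝ) (δ C : ℝ) (p : ℕ) : ℝ :=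
  (if p ∣ (2 * a * (b ^ 2 - 4 * a * c)).natAbs then 64 else 1) *
    Real.exp ((if IsSplitPrime a b c p then 2 * f p / p else 0) +
      4 * Real.exp C * δ * (Real.log p / p) + 84 * (1 / (p : ℝ) ^ (3 / 2 : ℝ)))

lemma tsum_rootMajorant_prime_pow_le {a b c : ℤ} {f : ℕ → ℝ} (hf0 : ∀ n, 0 ≤ f n) (hf1 : f 1 = 1)
    (hfτ : ∀ n, f n ≤ n.divisors.card) {δ C : ℝ} (hδ0 : 0 ≤ δ) (hδ : δ ≤ 1 / 4) {p : ℕ}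
    (hp : p.Prime) (hpC : δ * Real.log p ≤ C) :
    Summable (fun n => ‖rootMajorant a b c f (p ^ n) * ((p ^ n : ℕ) : ℝ) ^ (δ - 1)‖) ∧
      ∑' n, rootMajorant a b c f (p ^ n) * ((p ^ n : ℕ) : ℝ) ^ (δ - 1) ≤
        localFactorBound a b c f δ C p := by
  have hp0 : (0 : ℝ) < p := by exact_mod_cast hp.pos
  have hp2 : (2 : ℝ) ≤ p := by exact_mod_cast hp.two_le
  have hlog : 0 ≤ Real.log p := Real.log_nonneg (by linarith)
  set r : ℝ := (p : ℝ) ^ (δ - 1) with hr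
  have hr0 : 0 < r := Real.rpow_pos_of_pos hp0 _
  have hr34 : r ≤ (p : ℝ) ^ (-(3 / 4) : ℝ) :=
    Real.rpow_le_rpow_of_exponent_le (by linarith) (by linarith)
  have hr35 : r ≤ 3 / 5 := by
    refine hr34.trans ?_
    calc (p : ℝ) ^ (-(3 / 4) : ℝ) ≤ 2 ^ (-(3 / 4) : ℝ) :=
          Real.rpow_le_rpow_of_nonpos (by norm_num) hp2 (by norm_num)
      _ ≤ 3 / 5 := by
          refine le_of_pow_le_pow_left₀ (n := 4) (by norm_num) (by norm_num) ?_
          rw [← Real.rpow_natCast, ← Real.rpow_mul (by norm_num)]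
          norm_num
  have hr2 : r ^ 2 ≤ 1 / (p : ℝ) ^ (3 / 2 : ℝ) := by
    rw [one_div, ← Real.rpow_neg hp0.le]
    calc r ^ 2 ≤ ((p : ℝ) ^ (-(3 / 4) : ℝ)) ^ 2 := by gcongr
      _ = _ := by
        rw [← Real.rpow_natCast, ← Real.rpow_mul hp0.le]
        norm_num
  have hrp : r / p ≤ 1 / (p : ℝ) ^ (3 / 2 : ℝ) := by
    rw [one_div, ← Real.rpow_neg hp0.le]
    calc r / p ≤ (p : ℝ) ^ (-(3 / 4) : ℝ) / p := by gcongr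
      _ = (p : ℝ) ^ (-(3 / 4) - 1 : ℝ) := by rw [Real.rpow_sub hp0, Real.rpow_one]
      _ ≤ _ := Real.rpow_le_rpow_of_exponent_le (by linarith) (by norm_num)
  set κ : ℝ := rootWeight a b c p * Real.exp (2 / p) with hκ
  have hwt : (rootWeight a b c p : ℝ) ≤ 2 := by exact_mod_cast rootWeight_le_two a b c p
  have hκ0 : 0 ≤ κ := by positivity
  have h2p : 2 / (p : ℝ) ≤ 1 := by rw [div_le_one hp0]; exact hp2
  have hκ6 : κ ≤ 6 := by
    calc κ ≤ 2 * Real.exp 1 := by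
          rw [hκ]
          gcongr
      _ ≤ 6 := by linarith [Real.exp_one_lt_d9]
  set g : ℕ → ℝ := fun n => if n = 0 then 1 else f (p ^ n) * κ with hg
  have hterm : ∀ n : ℕ, rootMajorant a b c f (p ^ n) * ((p ^ n : ℕ) : ℝ) ^ (δ - 1) = g n * r ^ n := by
    intro n
    have hpow : ((p ^ n : ℕ) : ℝ) ^ (δ - 1) = r ^ n := by
      rw [Nat.cast_pow, hr, ← Real.rpow_natCast, ← Real.rpow_natCast, ← Real.rpow_mul hp0.le,
        ← Real.rpow_mul hp0.le, mul_comm]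
    rw [hpow]
    rcases eq_or_ne n 0 with rfl | hn
    · simp [hg, rootMajorant, hf1]
    · simp only [hg, if_neg hn, rootMajorant, Nat.primeFactors_prime_pow hn hp,
        Finset.prod_singleton, hκ]
  have hτ : ∀ n : ℕ, f (p ^ n) ≤ n + 1 := by
    intro n
    refine (hfτ _).trans (le_of_eq ?_)
    rw [Nat.divisors_prime_pow hp]
    simp
  have hg0 : ∀ n, 0 ≤ g n := by
    intro n
    simp only [hg]
    split_ifs
    · exact zero_le_one
    · exact mul_nonneg (hf0 _) hκ0
  have hg6 : ∀ n : ℕ, g n ≤ 6 * (n + 1) := by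
    intro n
    simp only [hg]
    split_ifs with h
    · subst h; norm_num
    · rw [mul_comm]
      exact mul_le_mul hκ6 (hτ n) (hf0 _) (by norm_num)
  obtain ⟨hsum, hle⟩ := tsum_mul_pow_le hg0 hg6 hr0.le hr35
  have hg00 : g 0 = 1 := by simp [hg]
  have hg11 : g 1 = f p * κ := by simp [hg]
  have hfp : f p ≤ 2 := by
    have := hτ 1
    rw [pow_one] at this
    norm_num at this
    linarith
  simp only [hterm]
  refine ⟨?_, hle.trans ?_⟩
  · exact hsum.congr fun n =>
      (Real.norm_of_nonneg (mul_nonneg (hg0 n) (pow_nonneg hr0.le n))).symm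
  rw [hg00, hg11, localFactorBound]
  have hx : 0 ≤ 4 * Real.exp C * δ * (Real.log p / p) := by positivity
  have hs : 0 ≤ (if IsSplitPrime a b c p then 2 * f p / p else 0) := by
    split_ifs
    · have := hf0 p
      positivity
    · exact le_rfl
  have hq : 0 ≤ 1 / (p : ℝ) ^ (3 / 2 : ℝ) := by positivity
  by_cases hbad : p ∣ (2 * a * (b ^ 2 - 4 * a * c)).natAbs
  · rw [if_pos hbad]
    have h1 : 1 + f p * κ * r + 68 * r ^ 2 ≤ 64 := by
      have h2 : f p * κ * r ≤ 2 * 6 * (3 / 5) := by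
        have := hf0 p
        gcongr
      nlinarith
    have h3 : 1 ≤ Real.exp ((if IsSplitPrime a b c p then 2 * f p / p else 0) +
      4 * Real.exp C * δ * (Real.log p / p) + 84 * (1 / (p : ℝ) ^ (3 / 2 : ℝ))) :=
      Real.one_le_exp (by linarith)
    linarith
  rw [if_neg hbad, one_mul]
  refine le_trans ?_ (Real.add_one_le_exp _)
  by_cases hsp : IsSplitPrime a b c p
  · rw [if_pos hsp]
    have hw2 : rootWeight a b c p = 2 := if_pos (Or.inl hsp)
    have he : Real.exp (2 / p) ≤ 1 + 4 / p := by
      have h1 := Real.abs_exp_sub_one_sub_id_le (x := 2 / (p : ℝ))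
        (by rw [abs_of_nonneg (by positivity)]; exact h2p)
      have h2 := (abs_le.mp h1).2
      have h3 : (2 / (p : ℝ)) ^ 2 ≤ 2 / p := by
        rw [sq]
        exact mul_le_of_le_one_left (by positivity) h2p
      have h4 : (4 : ℝ) / p = 2 * (2 / p) := by ring
      rw [h4]
      linarith
    have hrr : r ≤ 1 / p + Real.exp C * δ * (Real.log p / p) := by
      have h1 : r = Real.exp (δ * Real.log p) / p := by
        rw [hr, Real.rpow_sub hp0, Real.rpow_one, Real.rpow_def_of_pos hp0, mul_comm]
      have h2 : Real.exp (δ * Real.log p) ≤ 1 + δ * Real.log p * Real.exp C := by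
        have h3 := Real.add_one_le_exp (-(δ * Real.log p))
        have h4 : Real.exp (δ * Real.log p) * Real.exp (-(δ * Real.log p)) = 1 := by
          rw [← Real.exp_add, add_neg_cancel, Real.exp_zero]
        have h5 : Real.exp (δ * Real.log p) ≤ Real.exp C := Real.exp_le_exp.mpr hpC
        have h6 : 0 ≤ δ * Real.log p := by positivity
        have h7 := mul_le_mul_of_nonneg_left h3 (Real.exp_nonneg (δ * Real.log p))
        rw [h4] at h7
        have h8 := mul_le_mul_of_nonneg_left h5 h6
        linarith
      rw [h1]
      calc Real.exp (δ * Real.log p) / p ≤ (1 + δ * Real.log p * Real.exp C) / p := by gcongr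
        _ = _ := by ring
    have hmain : f p * κ * r ≤
        2 * f p / p + 4 * Real.exp C * δ * (Real.log p / p) + 16 * (r / p) := by
      rw [hκ, hw2]
      have hf := hf0 p
      calc f p * ((2 : ℕ) * Real.exp (2 / p)) * r ≤ f p * ((2 : ℕ) * (1 + 4 / p)) * r := by gcongr
        _ = 2 * f p * r + 8 * f p * (r / p) := by push_cast; ring
        _ ≤ 2 * f p * (1 / p + Real.exp C * δ * (Real.log p / p)) + 8 * 2 * (r / p) := by gcongr
        _ = 2 * f p / p + 2 * f p * (Real.exp C * δ * (Real.log p / p)) + 16 * (r / p) := by ring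
        _ ≤ 2 * f p / p + 2 * 2 * (Real.exp C * δ * (Real.log p / p)) + 16 * (r / p) := by gcongr
        _ = _ := by ring
    linarith
  · rw [if_neg hsp]
    have hw0 : rootWeight a b c p = 0 := if_neg (by tauto)
    rw [hκ, hw0, Nat.cast_zero, zero_mul, mul_zero, zero_mul]
    linarith

lemma rootMajorant_nonneg (a b c : ℤ) {f : ℕ → ℝ} (hf0 : ∀ n, 0 ≤ f n) (n : ℕ) :
    0 ≤ rootMajorant a b c f n :=
  mul_nonneg (hf0 n) (Finset.prod_nonneg fun _ _ => by positivity)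

lemma rootMajorant_mul (a b c : ℤ) {f : ℕ → ℝ}
    (hfm : ∀ m n, Nat.Coprime m n → f (m * n) = f m * f n) {m n : ℕ} (h : m.Coprime n) :
    rootMajorant a b c f (m * n) = rootMajorant a b c f m * rootMajorant a b c f n := by
  rw [rootMajorant, hfm m n h, h.primeFactors_mul, Finset.prod_union h.disjoint_primeFactors,
    rootMajorant, rootMajorant]
  ring

lemma prod_localFactorBound_le {a b c : ℤ} (hE : 2 * a * (b ^ 2 - 4 * a * c) ≠ 0) {f : ℕ → ℝ}
    {δ C : ℝ} (hδ : 0 ≤ δ) {w : ℕ} (hw : 1 ≤ w) (hwC : δ * Real.log w ≤ C) :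
    ∏ p ∈ (Finset.Icc 1 w).filter Nat.Prime, localFactorBound a b c f δ C p ≤
      ((2 * a * (b ^ 2 - 4 * a * c)).natAbs : ℝ) ^ 6 *
        Real.exp ((∑ p ∈ splitPrimes a b c w, 2 * f p / p) +
          (8 * Real.exp C * C + 84 * ∑' n : ℕ, 1 / (n : ℝ) ^ (3 / 2 : ℝ))) := by
  set E := (2 * a * (b ^ 2 - 4 * a * c)).natAbs with hEd
  have hE0 : E ≠ 0 := Int.natAbs_ne_zero.mpr hE
  simp only [localFactorBound]
  rw [Finset.prod_mul_distrib, ← Real.exp_sum]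
  refine mul_le_mul ?_ ?_ (Real.exp_nonneg _) (by positivity)
  · have h1 : ∏ p ∈ (Finset.Icc 1 w).filter Nat.Prime, (if p ∣ E then (64 : ℝ) else 1) ≤
        64 ^ E.primeFactors.card := by
      rw [← Finset.prod_filter, Finset.prod_const]
      refine pow_le_pow_right₀ (by norm_num) (Finset.card_le_card fun p hp => ?_)
      rw [Finset.mem_filter, Finset.mem_filter] at hp
      exact Nat.mem_primeFactors.mpr ⟨hp.1.2, hp.2, hE0⟩
    refine h1.trans ?_
    have h2 : ((2 : ℝ) ^ E.primeFactors.card) ≤ E := by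
      exact_mod_cast two_pow_card_primeFactors_le hE0
    calc (64 : ℝ) ^ E.primeFactors.card = ((2 : ℝ) ^ E.primeFactors.card) ^ 6 := by
          rw [← pow_mul, mul_comm, pow_mul]; norm_num
      _ ≤ _ := by gcongr
  · refine Real.exp_le_exp.mpr ?_
    rw [Finset.sum_add_distrib, Finset.sum_add_distrib, ← Finset.mul_sum, ← Finset.mul_sum,
      add_assoc]
    refine add_le_add (le_of_eq ?_) (add_le_add ?_ ?_)
    · rw [← Finset.sum_filter]
      refine Finset.sum_congr ?_ fun _ _ => rfl
      ext p
      rw [splitPrimes, Finset.mem_filter, Finset.mem_filter, Finset.mem_filter]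
      exact ⟨fun h => ⟨h.1.1, h.2⟩, fun h => ⟨⟨h.1, h.2.1⟩, h.2⟩⟩
    · calc 4 * Real.exp C * δ * ∑ p ∈ (Finset.Icc 1 w).filter Nat.Prime, Real.log p / p ≤
            4 * Real.exp C * δ * (2 * Real.log w) := by
            gcongr
            exact sum_log_div_primes_le w hw
        _ = 8 * Real.exp C * (δ * Real.log w) := by ring
        _ ≤ _ := by gcongr
    · gcongr
      exact (Real.summable_one_div_nat_rpow.mpr (by norm_num)).sum_le_tsum _
        fun _ _ => by positivity

lemma sum_rootMajorant_smooth_le {a b c : ℤ} (hE : 2 * a * (b ^ 2 - 4 * a * c) ≠ 0) {f : ℕ → ℝ}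
    (hf0 : ∀ n, 0 ≤ f n) (hf1 : f 1 = 1) (hfm : ∀ m n, Nat.Coprime m n → f (m * n) = f m * f n)
    (hfτ : ∀ n, f n ≤ n.divisors.card) {δ C : ℝ} (hδ0 : 0 ≤ δ) (hδ : δ ≤ 1 / 4) {w : ℕ}
    (hw : 1 ≤ w) (hwC : δ * Real.log w ≤ C) {V : ℝ} (hV : 0 < V) (A : Finset ℕ)
    (hA : ∀ d ∈ A, d ≠ 0 ∧ V ≤ d ∧ ∀ p, p.Prime → p ∣ d → p ≤ w) :
    ∑ d ∈ A, rootMajorant a b c f d / d ≤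
      V ^ (-δ) * (((2 * a * (b ^ 2 - 4 * a * c)).natAbs : ℝ) ^ 6 *
        Real.exp ((∑ p ∈ splitPrimes a b c w, 2 * f p / p) +
          (8 * Real.exp C * C + 84 * ∑' n : ℕ, 1 / (n : ℝ) ^ (3 / 2 : ℝ)))) := by
  set H : ℕ → ℝ := fun n => rootMajorant a b c f n * (n : ℝ) ^ (δ - 1) with hH
  have hH0 : ∀ n, 0 ≤ H n := fun n =>
    mul_nonneg (rootMajorant_nonneg a b c hf0 n) (Real.rpow_nonneg (Nat.cast_nonneg n) _)
  have hH1 : H 1 = 1 := by simp [hH, rootMajorant, hf1]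
  have hHm : ∀ {m n : ℕ}, m.Coprime n → H (m * n) = H m * H n := by
    intro m n h
    simp only [hH]
    rw [rootMajorant_mul a b c hfm h, Nat.cast_mul,
      Real.mul_rpow (Nat.cast_nonneg m) (Nat.cast_nonneg n)]
    ring
  have hloc : ∀ p, p.Prime → p ≤ w → Summable (fun n => ‖H (p ^ n)‖) ∧
      ∑' n, H (p ^ n) ≤ localFactorBound a b c f δ C p := by
    intro p hp hpw
    refine tsum_rootMajorant_prime_pow_le hf0 hf1 hfτ hδ0 hδ hp (le_trans ?_ hwC)
    have : Real.log p ≤ Real.log w :=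
      Real.log_le_log (by exact_mod_cast hp.pos) (by exact_mod_cast hpw)
    gcongr
  have hsum : ∀ {p : ℕ}, p.Prime → Summable (fun n => ‖H (p ^ n)‖) := by
    intro p hp
    exact (tsum_rootMajorant_prime_pow_le hf0 hf1 hfτ hδ0 hδ hp le_rfl).1
  obtain ⟨hS, hprod⟩ :=
    EulerProduct.summable_and_hasSum_smoothNumbers_prod_primesBelow_tsum hH1 hHm hsum (w + 1)
  have hAs : ∀ d ∈ A, d ∈ (w + 1).smoothNumbers := fun d hd =>
    Nat.mem_smoothNumbers'.mpr fun p hp hpd => Nat.lt_succ_of_le ((hA d hd).2.2 p hp hpd)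
  have h1 : ∑ d ∈ A, H d ≤ ∏ p ∈ (w + 1).primesBelow, ∑' n, H (p ^ n) := by
    rw [← Finset.sum_subtype_of_mem H hAs]
    exact sum_le_hasSum _ (fun i _ => hH0 _) hprod
  have h2 : ∏ p ∈ (w + 1).primesBelow, ∑' n, H (p ^ n) ≤
      ∏ p ∈ (Finset.Icc 1 w).filter Nat.Prime, localFactorBound a b c f δ C p := by
    have he : (w + 1).primesBelow = (Finset.Icc 1 w).filter Nat.Prime := by
      ext p
      rw [Nat.mem_primesBelow, Finset.mem_filter, Finset.mem_Icc]
      exact ⟨fun h => ⟨⟨h.2.one_le, Nat.lt_succ_iff.mp h.1⟩, h.2⟩,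
        fun h => ⟨Nat.lt_succ_iff.mpr h.1.2, h.2⟩⟩
    rw [he]
    refine Finset.prod_le_prod (fun p _ => tsum_nonneg fun n => hH0 _) fun p hp => ?_
    rw [Finset.mem_filter, Finset.mem_Icc] at hp
    exact (hloc p hp.2 hp.1.2).2
  have h3 : ∀ d ∈ A, rootMajorant a b c f d / d ≤ V ^ (-δ) * H d := by
    intro d hd
    obtain ⟨hd0, hVd, _⟩ := hA d hd
    have hdpos : (0 : ℝ) < d := by exact_mod_cast Nat.pos_of_ne_zero hd0
    have h4 : 1 ≤ V ^ (-δ) * (d : ℝ) ^ δ := by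
      rw [Real.rpow_neg hV.le, inv_mul_eq_div, one_le_div (by positivity)]
      gcongr
    have hG := rootMajorant_nonneg a b c hf0 d
    calc rootMajorant a b c f d / d ≤ rootMajorant a b c f d / d * (V ^ (-δ) * (d : ℝ) ^ δ) :=
          le_mul_of_one_le_right (by positivity) h4
      _ = _ := by
          simp only [hH]
          rw [Real.rpow_sub hdpos, Real.rpow_one]
          ring
  calc ∑ d ∈ A, rootMajorant a b c f d / d ≤ ∑ d ∈ A, V ^ (-δ) * H d := Finset.sum_le_sum h3
    _ = V ^ (-δ) * ∑ d ∈ A, H d := by rw [Finset.mul_sum]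
    _ ≤ _ := by
        refine mul_le_mul_of_nonneg_left ?_ (by positivity)
        exact h1.trans (h2.trans (prod_localFactorBound_le hE hδ0 hw hwC))

lemma apply_le_of_hasScaledFactorization {f : ℕ → ℝ} (hf0 : ∀ n, 0 ≤ f n)
    (hfm : ∀ m n, Nat.Coprime m n → f (m * n) = f m * f n) (hfτ : ∀ n, f n ≤ n.divisors.card)
    {L X j m d : ℕ} (hX : 2 ≤ X) (hm : m ≠ 0) (hmX : m ≤ X ^ 3)
    (h : HasScaledFactorization L X j m d) : f m ≤ f d * 2 ^ (24 * 2 ^ j) := by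
  obtain ⟨r, hdr, hcop, -, -, hrough, -⟩ := h
  have hr0 : r ≠ 0 := fun h0 => hm (by rw [← hdr, h0, mul_zero])
  have hX1 : (1 : ℝ) < X := by exact_mod_cast hX
  have hX0 : (0 : ℝ) < X := by linarith
  set y : ℝ := (X : ℝ) ^ ((1 : ℝ) / (8 * 2 ^ j)) with hy
  have hy1 : 1 < y := Real.one_lt_rpow hX1 (by positivity)
  have hyX : y ^ (24 * 2 ^ j) = (X : ℝ) ^ 3 := by
    have he : (1 : ℝ) / (8 * 2 ^ j) * ((24 * 2 ^ j : ℕ) : ℝ) = (3 : ℕ) := by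
      push_cast
      field_simp
      norm_num
    rw [hy, ← Real.rpow_natCast, ← Real.rpow_mul hX0.le, he, Real.rpow_natCast]
  have hcard : r.divisors.card ≤ 2 ^ (24 * 2 ^ j) := by
    refine card_divisors_le_of_rough hr0 hy1 (fun p hp hpr => ?_) ?_
    · have h1 := hrough p hp hpr
      have hp0 : (0 : ℝ) < p := by exact_mod_cast hp.pos
      rw [hy, Real.rpow_def_of_pos hX0, ← Real.le_log_iff_exp_le hp0, mul_one_div,
        div_le_iff₀ (by positivity)]
      linarith
    · rw [hyX]
      have : r ≤ m := by
        rw [← hdr]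
        refine Nat.le_mul_of_pos_left _ (Nat.pos_of_ne_zero fun h0 => hm ?_)
        rw [← hdr, h0, zero_mul]
      exact_mod_cast this.trans hmX
  rw [← hdr, hfm d r hcop]
  refine mul_le_mul_of_nonneg_left ((hfτ r).trans ?_) (hf0 d)
  exact_mod_cast hcard

lemma card_hasScaledFactorization_le {ε : ℝ} (hε : 0 < ε) :
    ∃ C : ℝ, 0 < C ∧ ∀ (a b c : ℤ) (L X j d : ℕ), 2 ≤ X → 0 < d → (d : ℝ) ^ 4 ≤ X →
    (((Finset.Icc 1 X).filter (fun n : ℕ => HasScaledFactorization L X j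
      (a * (n : ℤ) ^ 2 + b * (n : ℤ) + c).natAbs d)).card : ℝ) ≤
      C * Real.exp (ε * ∑ p ∈ splitPrimes a b c X, (1 : ℝ) / p) * ((X : ℝ) / d) *
        (rootsMod a b c d).card *
        (Real.exp (2 * ∑ p ∈ splitPrimes a b c ⌊(X : ℝ) ^ ((1 : ℝ) / (8 * 2 ^ j))⌋₊ with p ∣ d,
          (1 : ℝ) / p) * Real.exp (-(2 * ∑ p ∈ splitPrimes a b c X, (1 : ℝ) / p) + 8 * (j + 3))) := by
  obtain ⟨C, hC, hmain⟩ := exists_card_sifted_le hε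
  refine ⟨C, hC, fun a b c L X j d hX hd hdX => ?_⟩
  have hX1 : (1 : ℝ) < X := by exact_mod_cast hX
  have hX0 : (0 : ℝ) < X := by linarith
  set y : ℝ := (X : ℝ) ^ ((1 : ℝ) / (8 * 2 ^ j)) with hy
  have hy1 : 1 < y := Real.one_lt_rpow hX1 (by positivity)
  have hyX : (X : ℝ) = y ^ (2 ^ (j + 3)) := by
    rw [hy, ← Real.rpow_natCast, ← Real.rpow_mul hX0.le]
    push_cast
    rw [pow_add]
    norm_num
    rw [show ((2 : ℝ) ^ j)⁻¹ * (1 / 8) * (2 ^ j * 8) = 1 by field_simp, Real.rpow_one]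
  have hyle : ⌊y⌋₊ ≤ X := by
    have : y ≤ X := by
      rw [hy]
      calc (X : ℝ) ^ ((1 : ℝ) / (8 * 2 ^ j)) ≤ (X : ℝ) ^ (1 : ℝ) := by
            refine Real.rpow_le_rpow_of_exponent_le hX1.le ?_
            rw [div_le_one (by positivity)]
            have : (1 : ℝ) ≤ 2 ^ j := one_le_pow₀ (by norm_num)
            linarith
        _ = X := Real.rpow_one _
    exact Nat.floor_le_of_le this
  have hcard := hmain a b c X d ⌊y⌋₊ hX hd hdX hyle
  have hsub : (Finset.Icc 1 X).filter (fun n : ℕ => HasScaledFactorization L X j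
      (a * (n : ℤ) ^ 2 + b * (n : ℤ) + c).natAbs d) ⊆
      (Finset.Icc 1 X).filter (fun n : ℕ => (d : ℤ) ∣ a * (n : ℤ) ^ 2 + b * (n : ℤ) + c ∧
      ∀ p, IsSplitPrime a b c p → p ≤ ⌊y⌋₊ → ¬ p ∣ d →
        ¬ (p : ℤ) ∣ a * (n : ℤ) ^ 2 + b * (n : ℤ) + c) := by
    intro n hn
    rw [Finset.mem_filter] at hn ⊢
    obtain ⟨hnX, r, hdr, hcop, -, -, hrough, -⟩ := hn
    refine ⟨hnX, ?_, fun p hp hpy hpd hpm => ?_⟩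
    · rw [Int.natCast_dvd, ← hdr]
      exact dvd_mul_right d r
    · rw [Int.natCast_dvd, ← hdr] at hpm
      have hpr := (hp.1.dvd_mul.mp hpm).resolve_left hpd
      have h1 := hrough p hp.1 hpr
      have hp0 : (0 : ℝ) < p := by exact_mod_cast hp.1.pos
      have h2 : (p : ℝ) ≤ y := (Nat.le_floor_iff (by linarith)).mp hpy
      rw [hy, Real.rpow_def_of_pos hX0, ← Real.log_le_iff_le_exp hp0, mul_one_div,
        le_div_iff₀ (by positivity)] at h2
      linarith
  refine (Nat.cast_le.mpr (Finset.card_le_card hsub)).trans (hcard.trans ?_)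
  refine mul_le_mul_of_nonneg_left ?_ (mul_nonneg (mul_nonneg (mul_nonneg hC.le
    (Real.exp_nonneg _)) (div_nonneg (Nat.cast_nonneg _) (Nat.cast_nonneg _))) (Nat.cast_nonneg _))
  rw [← Real.exp_add]
  refine Real.exp_le_exp.mpr ?_
  have h1 : ∑ p ∈ splitPrimes a b c ⌊y⌋₊ with p ∣ d, (1 : ℝ) / p +
      ∑ p ∈ splitPrimes a b c ⌊y⌋₊ with ¬ p ∣ d, (1 : ℝ) / p =
      ∑ p ∈ splitPrimes a b c ⌊y⌋₊, (1 : ℝ) / p := Finset.sum_filter_add_sum_filter_not _ _ _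
  have h2 : ∑ p ∈ splitPrimes a b c X, (1 : ℝ) / p ≤
      ∑ p ∈ splitPrimes a b c ⌊y⌋₊, (1 : ℝ) / p + 4 * ((j : ℝ) + 3) := by
    have h3 := sum_inv_primes_le hy1 (j + 3) X hyX.le
    push_cast at h3
    refine le_trans ?_ (add_le_add_right h3 _)
    refine le_trans (Finset.sum_le_sum_of_subset_of_nonneg
      (t := splitPrimes a b c ⌊y⌋₊ ∪ (Finset.Icc 1 X).filter (fun p : ℕ => p.Prime ∧ y < p)) ?_
        fun _ _ _ => by positivity) ?_
    · intro p hp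
      rw [mem_splitPrimes] at hp
      rw [Finset.mem_union, mem_splitPrimes, Finset.mem_filter, Finset.mem_Icc]
      by_cases hpy : y < p
      · exact Or.inr ⟨⟨hp.1.1.one_le, hp.2⟩, hp.1.1, hpy⟩
      · exact Or.inl ⟨hp.1, Nat.le_floor (not_lt.mp hpy)⟩
    · rw [← Finset.sum_union_inter]
      exact le_add_of_nonneg_right (Finset.sum_nonneg fun _ _ => by positivity)
  linarith

lemma sum_hasScaledFactorization_le {ε : ℝ} (hε : 0 < ε) :
    ∃ K : ℝ, 0 < K ∧ ∀ (a b c : ℤ) (f : ℕ → ℝ), 2 * a * (b ^ 2 - 4 * a * c) ≠ 0 →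
      (∀ n, 0 ≤ f n) → f 1 = 1 → (∀ m n, Nat.Coprime m n → f (m * n) = f m * f n) →
      (∀ n, f n ≤ n.divisors.card) → ∀ L X j : ℕ, 2 ≤ X →
      (∀ n ∈ Finset.Icc 1 X, (a * (n : ℤ) ^ 2 + b * (n : ℤ) + c).natAbs ≠ 0 ∧
        (a * (n : ℤ) ^ 2 + b * (n : ℤ) + c).natAbs ≤ X ^ 3) →
      960 * 2 ^ j ≤ Real.log X →
      ∑ n ∈ (Finset.Icc 1 X).filter (fun n : ℕ => ∃ d, HasScaledFactorization L X j
          (a * (n : ℤ) ^ 2 + b * (n : ℤ) + c).natAbs d),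
        f (a * (n : ℤ) ^ 2 + b * (n : ℤ) + c).natAbs ≤
      K * ((2 * a * (b ^ 2 - 4 * a * c)).natAbs : ℝ) ^ 7 * X *
        Real.exp (ε * ∑ p ∈ splitPrimes a b c X, (1 : ℝ) / p) *
        Real.exp (∑ p ∈ splitPrimes a b c X, 2 * (f p - 1) / p) * Real.exp (-5 * j) := by
  obtain ⟨C, hC, hcard⟩ := card_hasScaledFactorization_le hε
  set K₀ : ℝ := 8 * Real.exp 60 * 60 + 84 * ∑' n : ℕ, 1 / (n : ℝ) ^ (3 / 2 : ℝ) with hK₀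
  refine ⟨C * Real.exp (54 + K₀), mul_pos hC (Real.exp_pos _), ?_⟩
  intro a b c f hE hf0 hf1 hfm hfτ L X j hX hQ hj
  have hX1 : (1 : ℝ) < X := by exact_mod_cast hX
  have hX0 : (0 : ℝ) < X := by linarith
  have h2j : (0 : ℝ) < 2 ^ j := pow_pos two_pos j
  have hlog : 0 < Real.log X := Real.log_pos hX1
  set q : ℕ → ℕ := fun n => (a * (n : ℤ) ^ 2 + b * (n : ℤ) + c).natAbs with hq
  set E : ℕ := (2 * a * (b ^ 2 - 4 * a * c)).natAbs with hEdef
  set T : ℝ := ∑ p ∈ splitPrimes a b c X, (1 : ℝ) / p with hT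
  set A : Finset ℕ := (Finset.Icc 1 X).filter
    (fun d : ℕ => ∃ m, HasScaledFactorization L X j m d) with hA
  have hmemA : ∀ n ∈ Finset.Icc 1 X, ∀ d, HasScaledFactorization L X j (q n) d → d ∈ A := by
    intro n hn d h
    refine Finset.mem_filter.mpr ⟨?_, q n, h⟩
    obtain ⟨r, hdr, -, hd4, -⟩ := h
    have hd : 0 < d := Nat.pos_of_ne_zero fun h0 => (hQ n hn).1 (by
      rw [show (a * (n : ℤ) ^ 2 + b * (n : ℤ) + c).natAbs = q n from rfl, ← hdr, h0, zero_mul])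
    have hd4' : d ^ 4 ≤ X := by exact_mod_cast hd4
    exact Finset.mem_Icc.mpr ⟨hd, (Nat.le_self_pow (by norm_num) d).trans hd4'⟩
  have hswap : ∑ n ∈ Finset.Icc 1 X with (∃ d, HasScaledFactorization L X j (q n) d), f (q n) ≤
      ∑ d ∈ A, ∑ n ∈ Finset.Icc 1 X with HasScaledFactorization L X j (q n) d, f (q n) := by
    rw [Finset.sum_filter]
    simp only [Finset.sum_filter]
    rw [Finset.sum_comm]
    refine Finset.sum_le_sum fun n hn => ?_
    have hnn : ∀ d ∈ A, 0 ≤ if HasScaledFactorization L X j (q n) d then f (q n) else 0 := by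
      intro d _
      split_ifs
      exacts [hf0 _, le_rfl]
    split_ifs with h
    · obtain ⟨d, hd⟩ := h
      refine le_trans ?_ (Finset.single_le_sum hnn (hmemA n hn d hd))
      rw [if_pos hd]
    · exact Finset.sum_nonneg hnn
  set c₁ : ℝ := C * Real.exp (ε * T) * X * Real.exp (-(2 * T) + 8 * (j + 3)) *
    2 ^ (24 * 2 ^ j) with hc₁
  have hc₁0 : 0 ≤ c₁ := mul_nonneg (mul_nonneg (mul_nonneg (mul_nonneg hC.le (Real.exp_nonneg _))
    hX0.le) (Real.exp_nonneg _)) (pow_nonneg zero_le_two _)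
  have hinner : ∀ d ∈ A, ∑ n ∈ Finset.Icc 1 X with HasScaledFactorization L X j (q n) d, f (q n) ≤
      c₁ * E * (rootMajorant a b c f d / d) := by
    intro d hd
    obtain ⟨hdX, m₀, r₀, -, -, hd4, -⟩ := Finset.mem_filter.mp hd
    have hd1 : 0 < d := (Finset.mem_Icc.mp hdX).1
    have hd0 : (0 : ℝ) < d := by exact_mod_cast hd1
    have h1 : ∑ n ∈ Finset.Icc 1 X with HasScaledFactorization L X j (q n) d, f (q n) ≤
        ((Finset.Icc 1 X).filter (fun n : ℕ => HasScaledFactorization L X j (q n) d)).card *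
          (f d * 2 ^ (24 * 2 ^ j)) := by
      rw [← nsmul_eq_mul]
      refine Finset.sum_le_card_nsmul _ _ _ fun n hn => ?_
      obtain ⟨hnX, h⟩ := Finset.mem_filter.mp hn
      exact apply_le_of_hasScaledFactorization hf0 hfm hfτ hX (hQ n hnX).1 (hQ n hnX).2 h
    refine h1.trans ((mul_le_mul_of_nonneg_right (hcard a b c L X j d hX hd1 hd4)
      (mul_nonneg (hf0 d) (pow_nonneg zero_le_two _))).trans ?_)
    have h2 := mul_card_rootsMod_mul_exp_le hE hd1.ne' (hf0 d)
      ⌊(X : ℝ) ^ ((1 : ℝ) / (8 * 2 ^ j))⌋₊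
    have h3 := mul_le_mul_of_nonneg_left (div_le_div_of_nonneg_right h2 hd0.le) hc₁0
    refine (le_of_eq ?_).trans (h3.trans_eq ?_)
    · rw [hc₁]
      ring
    · ring
  set δ : ℝ := 240 * 2 ^ j / Real.log X with hδ
  have hδ0 : 0 ≤ δ := div_nonneg (mul_nonneg (by norm_num) h2j.le) hlog.le
  have hδ4 : δ ≤ 1 / 4 := by
    rw [hδ, div_le_iff₀ hlog]
    linarith
  have hexp : (0 : ℝ) ≤ 1 / (4 * 2 ^ j) := div_nonneg zero_le_one (mul_nonneg (by norm_num) h2j.le)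
  set w : ℕ := ⌊(X : ℝ) ^ ((1 : ℝ) / (4 * 2 ^ j))⌋₊ with hw
  have hXw : (w : ℝ) ≤ (X : ℝ) ^ ((1 : ℝ) / (4 * 2 ^ j)) := Nat.floor_le (Real.rpow_nonneg hX0.le _)
  have hw1 : 1 ≤ w := by
    rw [hw, Nat.one_le_floor_iff]
    exact Real.one_le_rpow hX1.le hexp
  have hwC : δ * Real.log w ≤ 60 := by
    have h1 : Real.log w ≤ 1 / (4 * 2 ^ j) * Real.log X := by
      rw [← Real.log_rpow hX0]
      exact Real.log_le_log (by exact_mod_cast hw1) hXw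
    refine (mul_le_mul_of_nonneg_left h1 hδ0).trans_eq ?_
    rw [hδ]
    field_simp
    norm_num
  have hwX : w ≤ X := by
    have h1 : (w : ℝ) ≤ X := by
      refine hXw.trans ((Real.rpow_le_rpow_of_exponent_le hX1.le ?_).trans_eq (Real.rpow_one _))
      rw [div_le_one (mul_pos (by norm_num) h2j)]
      have : (1 : ℝ) ≤ 2 ^ j := one_le_pow₀ (by norm_num)
      linarith
    exact_mod_cast h1
  set V : ℝ := if j = 0 then 1 else (X : ℝ) ^ ((1 : ℝ) / 8) with hV
  have hV0 : 0 < V := by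
    rw [hV]
    split_ifs
    exacts [one_pos, Real.rpow_pos_of_pos hX0 _]
  have hVδ : V ^ (-δ) ≤ Real.exp (30 - 30 * 2 ^ j) := by
    rw [hV]
    split_ifs with h
    · rw [Real.one_rpow, h]
      norm_num
    · rw [← Real.rpow_mul hX0.le, Real.rpow_def_of_pos hX0]
      refine Real.exp_le_exp.mpr ?_
      have : Real.log X * (1 / 8 * -δ) = -(30 * 2 ^ j) := by
        rw [hδ]
        field_simp
        norm_num
      linarith
  have hAprop : ∀ d ∈ A, d ≠ 0 ∧ V ≤ d ∧ ∀ p, p.Prime → p ∣ d → p ≤ w := by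
    intro d hd
    obtain ⟨hdX, m₀, r₀, -, -, hd4, hsm, -, hj8⟩ := Finset.mem_filter.mp hd
    have hd1 : 1 ≤ d := (Finset.mem_Icc.mp hdX).1
    refine ⟨by omega, ?_, fun p hp hpd => ?_⟩
    · rw [hV]
      split_ifs with h
      · exact_mod_cast hd1
      · have h8 := (hj8.resolve_left h).1
        refine (Real.rpow_le_rpow hX0.le h8.le (by norm_num)).trans_eq ?_
        rw [← Real.rpow_natCast, ← Real.rpow_mul (Nat.cast_nonneg _)]
        norm_num
    · have hp0 : (0 : ℝ) < p := by exact_mod_cast hp.pos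
      refine Nat.le_floor ?_
      rw [Real.rpow_def_of_pos hX0, ← Real.log_le_iff_le_exp hp0, mul_one_div,
        le_div_iff₀ (mul_pos (by norm_num) h2j)]
      linarith [hsm p hp hpd]
  have hsmooth := sum_rootMajorant_smooth_le hE hf0 hf1 hfm hfτ hδ0 hδ4 hw1 hwC hV0 A hAprop
  rw [← hK₀] at hsmooth
  have hwsum : ∑ p ∈ splitPrimes a b c w, 2 * f p / p ≤ ∑ p ∈ splitPrimes a b c X, 2 * f p / p := by
    refine Finset.sum_le_sum_of_subset_of_nonneg (fun p hp => ?_) fun p _ _ =>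
      div_nonneg (mul_nonneg zero_le_two (hf0 p)) (Nat.cast_nonneg p)
    rw [mem_splitPrimes] at hp ⊢
    exact ⟨hp.1, hp.2.trans hwX⟩
  have hsplit : ∑ p ∈ splitPrimes a b c X, 2 * (f p - 1) / p =
      ∑ p ∈ splitPrimes a b c X, 2 * f p / p - 2 * T := by
    rw [hT, Finset.mul_sum, ← Finset.sum_sub_distrib]
    refine Finset.sum_congr rfl fun p _ => ?_
    ring
  have htwo : (2 : ℝ) ^ (24 * 2 ^ j) ≤ Real.exp (17 * 2 ^ j) := by
    rw [← Real.rpow_natCast, Real.rpow_def_of_pos two_pos]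
    refine Real.exp_le_exp.mpr ?_
    push_cast
    nlinarith [Real.log_two_lt_d9]
  have hj2 : (j : ℝ) + 1 ≤ 2 ^ j := by exact_mod_cast Nat.lt_two_pow_self
  calc _ ≤ _ := hswap
    _ ≤ ∑ d ∈ A, c₁ * E * (rootMajorant a b c f d / d) := Finset.sum_le_sum hinner
    _ = c₁ * E * ∑ d ∈ A, rootMajorant a b c f d / d := by rw [Finset.mul_sum]
    _ ≤ c₁ * E * (Real.exp (30 - 30 * 2 ^ j) * ((E : ℝ) ^ 6 *
        Real.exp ((∑ p ∈ splitPrimes a b c X, 2 * f p / p) + K₀))) := by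
      refine mul_le_mul_of_nonneg_left (hsmooth.trans ?_) (mul_nonneg hc₁0 (Nat.cast_nonneg _))
      refine mul_le_mul hVδ (mul_le_mul_of_nonneg_left (Real.exp_le_exp.mpr ?_)
        (pow_nonneg (Nat.cast_nonneg _) _)) (mul_nonneg (pow_nonneg (Nat.cast_nonneg _) _)
          (Real.exp_nonneg _)) (Real.exp_nonneg _)
      linarith
    _ = C * (E : ℝ) ^ 7 * X * Real.exp (ε * T) * (2 ^ (24 * 2 ^ j) *
        (Real.exp (-(2 * T) + 8 * (j + 3)) * Real.exp (30 - 30 * 2 ^ j) *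
        Real.exp ((∑ p ∈ splitPrimes a b c X, 2 * f p / p) + K₀))) := by
      rw [hc₁]
      ring
    _ ≤ C * (E : ℝ) ^ 7 * X * Real.exp (ε * T) * (Real.exp (54 + K₀) *
        Real.exp (∑ p ∈ splitPrimes a b c X, 2 * (f p - 1) / p) * Real.exp (-5 * j)) := by
      refine mul_le_mul_of_nonneg_left ?_ (mul_nonneg (mul_nonneg (mul_nonneg hC.le
        (pow_nonneg (Nat.cast_nonneg _) _)) hX0.le) (Real.exp_nonneg _))
      refine (mul_le_mul_of_nonneg_right htwo (mul_nonneg (mul_nonneg (Real.exp_nonneg _)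
        (Real.exp_nonneg _)) (Real.exp_nonneg _))).trans ?_
      simp only [← Real.exp_add]
      refine Real.exp_le_exp.mpr ?_
      rw [hsplit]
      nlinarith
    _ = _ := by ring

lemma sum_union_le_sum_add_sum {ι : Type*} [DecidableEq ι] {g : ι → ℝ} (hg : ∀ n, 0 ≤ g n) (s t : Finset ι) :
    ∑ n ∈ s ∪ t, g n ≤ ∑ n ∈ s, g n + ∑ n ∈ t, g n := by
  rw [← Finset.sum_union_inter]
  exact le_add_of_nonneg_right (Finset.sum_nonneg fun n _ => hg n)

lemma sum_biUnion_range_le {ι : Type*} [DecidableEq ι] {g : ι → ℝ} (hg : ∀ n, 0 ≤ g n) (u : ℕ → Finset ι) (N : ℕ) :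
    ∑ n ∈ (Finset.range N).biUnion u, g n ≤ ∑ j ∈ Finset.range N, ∑ n ∈ u j, g n := by
  induction N with
  | zero => simp
  | succ N ih =>
    rw [Finset.range_add_one, Finset.biUnion_insert, Finset.sum_insert Finset.notMem_range_self]
    exact (sum_union_le_sum_add_sum hg _ _).trans (add_le_add_right ih _)

lemma exp_neg_two_mul_sum_splitPrimes_le {f : ℕ → ℝ} (hf0 : ∀ n, 0 ≤ f n) {ε : ℝ} (hε : 0 < ε)
    (a b c : ℤ) (X : ℕ) :
    Real.exp (-(2 * ∑ p ∈ splitPrimes a b c X, (1 : ℝ) / p)) ≤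
      Real.exp (ε * ∑ p ∈ splitPrimes a b c X, (1 : ℝ) / p) *
        Real.exp (∑ p ∈ splitPrimes a b c X, 2 * (f p - 1) / p) := by
  rw [← Real.exp_add]
  refine Real.exp_le_exp.mpr ?_
  have h1 : -(2 * ∑ p ∈ splitPrimes a b c X, (1 : ℝ) / p) ≤
      ∑ p ∈ splitPrimes a b c X, 2 * (f p - 1) / p := by
    rw [← neg_mul, Finset.mul_sum]
    refine Finset.sum_le_sum fun p _ => ?_
    rw [mul_one_div]
    exact div_le_div_of_nonneg_right (by linarith [hf0 p]) (Nat.cast_nonneg p)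
  linarith [mul_nonneg hε.le (sum_splitPrimes_nonneg a b c X)]

lemma exists_sum_large_square_le {κ : ℝ} (hκ : 0 < κ) :
    ∃ K : ℝ, 0 < K ∧ ∀ (a b c : ℤ) (f : ℕ → ℝ), 2 * a * (b ^ 2 - 4 * a * c) ≠ 0 →
      (∀ n, f n ≤ n.divisors.card) → ∀ X : ℕ, 1 ≤ X →
      (∀ n ∈ Finset.Icc 1 X, (a * (n : ℤ) ^ 2 + b * (n : ℤ) + c).natAbs ≤ X ^ 3) →
      ∑ n ∈ (Finset.Icc 1 X).filter (fun n : ℕ => ∃ p k : ℕ, p.Prime ∧ 1 ≤ k ∧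
          (p ^ k) ^ 2 ∣ (a * (n : ℤ) ^ 2 + b * (n : ℤ) + c).natAbs ∧ (p ^ k) ^ 2 ≤ X ∧
          (X : ℝ) ^ κ < ((p ^ k : ℕ) : ℝ)),
        f (a * (n : ℤ) ^ 2 + b * (n : ℤ) + c).natAbs ≤
      K * (2 * a * (b ^ 2 - 4 * a * c)).natAbs * X *
        Real.exp (-(2 * ∑ p ∈ splitPrimes a b c X, (1 : ℝ) / p)) := by
  obtain ⟨C₁, hC₁, h₁⟩ := exists_card_divisors_le_rpow (θ := κ / 6) (by linarith)
  obtain ⟨C₂, hC₂, h₂⟩ := exists_exp_sum_splitPrimes_le (B := 2) (θ := κ / 2) two_pos (by linarith)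
  refine ⟨20 * C₁ * C₂, mul_pos (mul_pos (by norm_num) hC₁) hC₂, ?_⟩
  intro a b c f hE hfτ X hX hQ
  have hX0 : (0 : ℝ) < X := by exact_mod_cast hX
  set T : ℝ := ∑ p ∈ splitPrimes a b c X, (1 : ℝ) / p with hT
  set E : ℕ := (2 * a * (b ^ 2 - 4 * a * c)).natAbs with hEdef
  have hcard := card_dvd_by_large_square_le hE (Real.rpow_pos_of_pos hX0 κ) X
  set S : Finset ℕ := (Finset.Icc 1 X).filter (fun n : ℕ => ∃ p k : ℕ, p.Prime ∧ 1 ≤ k ∧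
          (p ^ k) ^ 2 ∣ (a * (n : ℤ) ^ 2 + b * (n : ℤ) + c).natAbs ∧ (p ^ k) ^ 2 ≤ X ∧
          (X : ℝ) ^ κ < ((p ^ k : ℕ) : ℝ)) with hS
  have hf : ∀ n ∈ S, f (a * (n : ℤ) ^ 2 + b * (n : ℤ) + c).natAbs ≤ C₁ * (X : ℝ) ^ (κ / 2) := by
    intro n hn
    refine (hfτ _).trans ((h₁ _).trans (mul_le_mul_of_nonneg_left ?_ hC₁.le))
    have h3 : (((a * (n : ℤ) ^ 2 + b * (n : ℤ) + c).natAbs : ℕ) : ℝ) ≤ (X : ℝ) ^ (3 : ℝ) := by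
      rw [Real.rpow_ofNat]
      exact_mod_cast hQ n (Finset.mem_filter.mp hn).1
    refine (Real.rpow_le_rpow (Nat.cast_nonneg _) h3 (by linarith)).trans_eq ?_
    rw [← Real.rpow_mul hX0.le]
    congr 1
    ring
  have hT2 : 1 ≤ C₂ * (X : ℝ) ^ (κ / 2) * Real.exp (-(2 * T)) := by
    have := mul_le_mul_of_nonneg_right (h₂ a b c X hX) (Real.exp_nonneg (-(2 * T)))
    rwa [← Real.exp_add, add_neg_cancel, Real.exp_zero] at this
  have hXκ : (X : ℝ) ^ (κ / 2) * (X : ℝ) ^ (κ / 2) = (X : ℝ) ^ κ := by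
    rw [← Real.rpow_add hX0, add_halves]
  have hκ0 := Real.rpow_pos_of_pos hX0 (κ / 2)
  calc _ ≤ (S.card : ℝ) * (C₁ * (X : ℝ) ^ (κ / 2)) := by
        rw [← nsmul_eq_mul]
        exact Finset.sum_le_card_nsmul _ _ _ hf
    _ ≤ 20 * E * X / (X : ℝ) ^ κ * (C₁ * (X : ℝ) ^ (κ / 2)) :=
        mul_le_mul_of_nonneg_right hcard (mul_nonneg hC₁.le hκ0.le)
    _ = 20 * C₁ * E * X / (X : ℝ) ^ (κ / 2) * 1 := by
        rw [← hXκ]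
        field_simp
    _ ≤ 20 * C₁ * E * X / (X : ℝ) ^ (κ / 2) *
          (C₂ * (X : ℝ) ^ (κ / 2) * Real.exp (-(2 * T))) :=
        mul_le_mul_of_nonneg_left hT2 (div_nonneg (mul_nonneg (mul_nonneg (mul_nonneg
          (by norm_num) hC₁.le) (Nat.cast_nonneg _)) hX0.le) hκ0.le)
    _ = _ := by
        field_simp

lemma exists_sum_apply_quadratic_le {ε : ℝ} (hε : 0 < ε) :
    ∃ (K : ℝ) (X₀ : ℕ), 0 < K ∧ ∀ (a b c : ℤ) (f : ℕ → ℝ), 2 * a * (b ^ 2 - 4 * a * c) ≠ 0 →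
      (∀ n, 0 ≤ f n) → f 1 = 1 → (∀ m n, Nat.Coprime m n → f (m * n) = f m * f n) →
      (∀ n, f n ≤ n.divisors.card) → ∀ X : ℕ, X₀ ≤ X →
      (∀ n ∈ Finset.Icc 1 X, (a * (n : ℤ) ^ 2 + b * (n : ℤ) + c).natAbs ≠ 0 ∧
        (a * (n : ℤ) ^ 2 + b * (n : ℤ) + c).natAbs ≤ X ^ 3) →
      ∑ n ∈ Finset.Icc 1 X, f (a * (n : ℤ) ^ 2 + b * (n : ℤ) + c).natAbs ≤
      K * ((2 * a * (b ^ 2 - 4 * a * c)).natAbs : ℝ) ^ 7 * X *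
        (Real.exp (ε * ∑ p ∈ splitPrimes a b c X, (1 : ℝ) / p) *
        Real.exp (∑ p ∈ splitPrimes a b c X, 2 * (f p - 1) / p)) := by
  obtain ⟨K₁, hK₁, h₁⟩ := sum_hasScaledFactorization_le hε
  obtain ⟨L, hL⟩ := exists_nat_ge (Real.exp 240)
  have hL241 : (241 : ℝ) ≤ L := by linarith [Real.add_one_le_exp (240 : ℝ)]
  have hL0 : (0 : ℝ) < L := by linarith
  have hL2 : 2 ≤ L := by
    have : (2 : ℝ) ≤ L := by linarith
    exact_mod_cast this
  have hlogL : 240 ≤ Real.log L := (Real.le_log_iff_exp_le hL0).mpr hL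
  set κ : ℝ := 1 / (24 * L) with hκdef
  have hκ : 0 < κ := one_div_pos.mpr (by linarith)
  obtain ⟨K₂, hK₂, h₂⟩ := exists_sum_large_square_le hκ
  obtain ⟨X₁, hX₁⟩ := exists_nat_ge ((L : ℝ) ^ (8 * (L : ℝ)))
  obtain ⟨X₂, hX₂⟩ := exists_nat_ge (Real.exp 960)
  refine ⟨K₂ + K₁ * 2, max X₁ X₂, add_pos hK₂ (mul_pos hK₁ two_pos), ?_⟩
  intro a b c f hE hf0 hf1 hfm hfτ X hX hQ
  have hXX₁ : (X₁ : ℝ) ≤ X := by exact_mod_cast (le_max_left _ _).trans hX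
  have hXX₂ : (X₂ : ℝ) ≤ X := by exact_mod_cast (le_max_right _ _).trans hX
  have hX961 : (961 : ℝ) ≤ X := by linarith [Real.add_one_le_exp (960 : ℝ)]
  have hX0 : (0 : ℝ) < X := by linarith
  have hX1 : (1 : ℝ) < X := by linarith
  have hX2 : 2 ≤ X := by exact_mod_cast hX1
  have hlogX : 960 ≤ Real.log X := (Real.le_log_iff_exp_le hX0).mpr (hX₂.trans hXX₂)
  set q : ℕ → ℕ := fun n => (a * (n : ℤ) ^ 2 + b * (n : ℤ) + c).natAbs with hq
  set E : ℕ := (2 * a * (b ^ 2 - 4 * a * c)).natAbs with hEdef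
  set T : ℝ := ∑ p ∈ splitPrimes a b c X, (1 : ℝ) / p with hT
  set M : ℝ := Real.exp (ε * T) * Real.exp (∑ p ∈ splitPrimes a b c X, 2 * (f p - 1) / p) with hM
  have hM0 : 0 ≤ M := mul_nonneg (Real.exp_nonneg _) (Real.exp_nonneg _)
  set bad : Finset ℕ := (Finset.Icc 1 X).filter (fun n : ℕ => ∃ p k : ℕ, p.Prime ∧ 1 ≤ k ∧
    (p ^ k) ^ 2 ∣ q n ∧ (p ^ k) ^ 2 ≤ X ∧ (X : ℝ) ^ κ < ((p ^ k : ℕ) : ℝ)) with hbad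
  set cls : ℕ → Finset ℕ := fun j => (Finset.Icc 1 X).filter
    (fun n : ℕ => ∃ d, HasScaledFactorization L X j (q n) d) with hcls
  have hscale : ∀ j m d, HasScaledFactorization L X j m d → 960 * 2 ^ j ≤ Real.log X := by
    rintro j m d ⟨r, -, -, -, -, -, rfl | ⟨-, h⟩⟩
    · simpa using hlogX
    · have h2j : (0 : ℝ) < 2 ^ j := pow_pos two_pos j
      nlinarith
  have hcover : Finset.Icc 1 X ⊆ bad ∪ (Finset.range X).biUnion cls := by
    intro n hn
    have hLY : (L : ℝ) ≤ (X : ℝ) ^ (1 / (8 * (L : ℝ))) := by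
      have h8 : (0 : ℝ) < 8 * L := by linarith
      calc (L : ℝ) = ((L : ℝ) ^ (8 * (L : ℝ))) ^ (1 / (8 * (L : ℝ))) := by
            rw [← Real.rpow_mul hL0.le, mul_one_div_cancel h8.ne', Real.rpow_one]
        _ ≤ _ := Real.rpow_le_rpow (Real.rpow_nonneg hL0.le _) (hX₁.trans hXX₁)
            (one_div_pos.mpr h8).le
    have hYX : ((X : ℝ) ^ (1 / (8 * (L : ℝ)))) ^ (8 * L) ≤ X := by
      rw [← Real.rpow_natCast, ← Real.rpow_mul hX0.le]
      push_cast
      rw [one_div_mul_cancel (by linarith), Real.rpow_one]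
    rw [Finset.mem_union]
    rcases exists_square_or_hasScaledFactorization (hQ n hn).1 hL2 hLY hYX with
      ⟨p, k, hp, hk, hdvd, h8, hY⟩ | ⟨j, d, h⟩
    · refine Or.inl (Finset.mem_filter.mpr ⟨hn, p, k, hp, hk, hdvd, ?_, ?_⟩)
      · have h8' : (p ^ k) ^ 8 ≤ X := by exact_mod_cast h8
        exact (Nat.pow_le_pow_right (pow_pos hp.pos k) (by norm_num)).trans h8'
      · refine lt_of_pow_lt_pow_left₀ 3 (Nat.cast_nonneg _) (lt_of_eq_of_lt ?_ hY)
        rw [← Real.rpow_natCast, ← Real.rpow_mul hX0.le, hκdef]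
        congr 1
        push_cast
        field_simp
        norm_num
    · refine Or.inr (Finset.mem_biUnion.mpr ⟨j, Finset.mem_range.mpr ?_,
        Finset.mem_filter.mpr ⟨hn, d, h⟩⟩)
      have h1 := hscale _ _ _ h
      have h2 : (j : ℝ) < 2 ^ j := by exact_mod_cast Nat.lt_two_pow_self
      have h3 := Real.log_le_sub_one_of_pos hX0
      have h4 : (j : ℝ) < X := by linarith
      exact_mod_cast h4
  have hclass : ∀ j, ∑ n ∈ cls j, f (q n) ≤ K₁ * (E : ℝ) ^ 7 * X * M * (1 / 2) ^ j := by
    intro j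
    have hc0 : 0 ≤ K₁ * (E : ℝ) ^ 7 * X * M := mul_nonneg (mul_nonneg (mul_nonneg hK₁.le
      (pow_nonneg (Nat.cast_nonneg _) _)) hX0.le) hM0
    rcases (cls j).eq_empty_or_nonempty with h0 | ⟨n, hn⟩
    · rw [h0, Finset.sum_empty]
      exact mul_nonneg hc0 (pow_nonneg (by norm_num) _)
    · obtain ⟨-, d, hd⟩ := Finset.mem_filter.mp hn
      refine (h₁ a b c f hE hf0 hf1 hfm hfτ L X j hX2 hQ (hscale _ _ _ hd)).trans ?_
      rw [mul_assoc _ (Real.exp (ε * T))]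
      refine mul_le_mul_of_nonneg_left ?_ hc0
      have h5 : Real.exp (-5) ≤ 1 / 2 := by
        rw [Real.exp_neg, ← one_div]
        exact one_div_le_one_div_of_le two_pos (by linarith [Real.add_one_le_exp (5 : ℝ)])
      rw [mul_comm (-5 : ℝ), Real.exp_nat_mul]
      exact pow_le_pow_left₀ (Real.exp_nonneg _) h5 j
  have hbadsum : ∑ n ∈ bad, f (q n) ≤ K₂ * (E : ℝ) ^ 7 * X * M := by
    refine (h₂ a b c f hE hfτ X (by omega) fun n hn => (hQ n hn).2).trans ?_
    have hE1 : (1 : ℝ) ≤ E := by exact_mod_cast Int.natAbs_pos.mpr hE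
    refine mul_le_mul (mul_le_mul_of_nonneg_right (mul_le_mul_of_nonneg_left
      (le_self_pow₀ hE1 (by norm_num)) hK₂.le) hX0.le)
      (exp_neg_two_mul_sum_splitPrimes_le hf0 hε a b c X) (Real.exp_nonneg _)
      (mul_nonneg (mul_nonneg hK₂.le (pow_nonneg (Nat.cast_nonneg _) _)) hX0.le)
  have hcls_sum : ∑ j ∈ Finset.range X, ∑ n ∈ cls j, f (q n) ≤ K₁ * (E : ℝ) ^ 7 * X * M * 2 := by
    refine (Finset.sum_le_sum fun j _ => hclass j).trans ?_
    rw [← Finset.mul_sum]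
    refine mul_le_mul_of_nonneg_left (sum_geometric_two_le X) ?_
    exact mul_nonneg (mul_nonneg (mul_nonneg hK₁.le (pow_nonneg (Nat.cast_nonneg _) _)) hX0.le) hM0
  have hsum : ∑ n ∈ Finset.Icc 1 X, f (q n) ≤
      ∑ n ∈ bad, f (q n) + ∑ j ∈ Finset.range X, ∑ n ∈ cls j, f (q n) :=
    (Finset.sum_le_sum_of_subset_of_nonneg hcover fun n _ _ => hf0 _).trans
      ((sum_union_le_sum_add_sum (fun n => hf0 (q n)) _ _).trans
        (add_le_add_right (sum_biUnion_range_le (fun n => hf0 (q n)) _ _) _))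
  refine hsum.trans ((add_le_add hbadsum hcls_sum).trans_eq ?_)
  ring

lemma quadratic_ne_zero_of_not_isSquare_discrim {a b c : ℤ} (hD : ¬ IsSquare (b ^ 2 - 4 * a * c))
    (n : ℤ) : a * n ^ 2 + b * n + c ≠ 0 :=
  fun h => hD ⟨2 * a * n + b, by linear_combination (-4 * a) * h⟩

lemma natAbs_two_mul_mul_discrim_le {a b c : ℤ} {M : ℕ} (ha : a.natAbs ≤ M) (hb : b.natAbs ≤ M)
    (hc : c.natAbs ≤ M) : (2 * a * (b ^ 2 - 4 * a * c)).natAbs ≤ 10 * M ^ 3 := by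
  have h1 : (b ^ 2 - 4 * a * c).natAbs ≤ 5 * M ^ 2 := by
    refine (Int.natAbs_sub_le _ _).trans ?_
    simp only [Int.natAbs_pow, Int.natAbs_mul]
    have h2 := Nat.pow_le_pow_left hb 2
    have h3 := Nat.mul_le_mul ha hc
    norm_num
    nlinarith
  rw [Int.natAbs_mul, Int.natAbs_mul]
  refine (Nat.mul_le_mul (Nat.mul_le_mul le_rfl ha) h1).trans_eq ?_
  norm_num
  ring

lemma natAbs_quadratic_le {a b c : ℤ} {M n X : ℕ} (ha : a.natAbs ≤ M) (hb : b.natAbs ≤ M)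
    (hc : c.natAbs ≤ M) (hn : 1 ≤ n) (hnX : n ≤ X) :
    (a * (n : ℤ) ^ 2 + b * (n : ℤ) + c).natAbs ≤ 3 * M * X ^ 2 := by
  refine (Int.natAbs_add_le _ _).trans ((add_le_add_left (Int.natAbs_add_le _ _) _).trans ?_)
  simp only [Int.natAbs_mul, Int.natAbs_pow, Int.natAbs_natCast]
  have h2 : n ^ 2 ≤ X ^ 2 := Nat.pow_le_pow_left hnX 2
  have h1 : n ≤ X ^ 2 := (Nat.le_self_pow two_ne_zero n).trans h2
  have h0 : 1 ≤ X ^ 2 := hn.trans h1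
  calc a.natAbs * n ^ 2 + b.natAbs * n + c.natAbs
      ≤ M * X ^ 2 + M * X ^ 2 + M * X ^ 2 := add_le_add (add_le_add (Nat.mul_le_mul ha h2)
        (Nat.mul_le_mul hb h1)) (hc.trans (Nat.le_mul_of_pos_right M h0))
    _ = 3 * M * X ^ 2 := by ring

lemma exists_sum_apply_quadratic_le_max {ε : ℝ} (hε : 0 < ε) :
    ∃ K : ℝ, 0 < K ∧ ∀ (a b c : ℤ) (f : ℕ → ℝ), a ≠ 0 → ¬ IsSquare (b ^ 2 - 4 * a * c) →
      (∀ n, 0 ≤ f n) → f 1 = 1 → (∀ m n, Nat.Coprime m n → f (m * n) = f m * f n) →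
      (∀ n, f n ≤ n.divisors.card) → ∀ X : ℕ, 1 ≤ X →
      ∑ n ∈ Finset.Icc 1 X, f (a * (n : ℤ) ^ 2 + b * (n : ℤ) + c).natAbs ≤
      K * ((max (max a.natAbs b.natAbs) c.natAbs : ℕ) : ℝ) ^ 21 * X *
        (Real.exp (ε * ∑ p ∈ splitPrimes a b c X, (1 : ℝ) / p) *
        Real.exp (∑ p ∈ splitPrimes a b c X, 2 * (f p - 1) / p)) := by
  obtain ⟨K₁, X₀, hK₁, h₁⟩ := exists_sum_apply_quadratic_le hε
  obtain ⟨C, hC, h₂⟩ := exists_exp_sum_splitPrimes_le (B := 2) (θ := 1) two_pos one_pos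
  refine ⟨K₁ * 10 ^ 7 + 3 * (X₀ + 3) ^ 3 * C, by positivity, ?_⟩
  intro a b c f ha hD hf0 hf1 hfm hfτ X hX
  set M : ℕ := max (max a.natAbs b.natAbs) c.natAbs with hM
  have haM : a.natAbs ≤ M := (le_max_left _ _).trans (le_max_left _ _)
  have hbM : b.natAbs ≤ M := (le_max_right _ _).trans (le_max_left _ _)
  have hcM : c.natAbs ≤ M := le_max_right _ _
  have hM1 : 1 ≤ M := (Int.natAbs_pos.mpr ha).trans_le haM
  have hM1' : (1 : ℝ) ≤ M := by exact_mod_cast hM1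
  have hX0 : (0 : ℝ) < X := by exact_mod_cast hX
  have hE : 2 * a * (b ^ 2 - 4 * a * c) ≠ 0 := mul_ne_zero (mul_ne_zero two_ne_zero ha)
    fun h => hD (h ▸ IsSquare.zero)
  set F : ℝ := Real.exp (ε * ∑ p ∈ splitPrimes a b c X, (1 : ℝ) / p) *
    Real.exp (∑ p ∈ splitPrimes a b c X, 2 * (f p - 1) / p) with hF
  have hF0 : 0 ≤ F := mul_nonneg (Real.exp_nonneg _) (Real.exp_nonneg _)
  have hA0 : 0 ≤ (M : ℝ) ^ 21 * X * F :=
    mul_nonneg (mul_nonneg (pow_nonneg (Nat.cast_nonneg _) _) hX0.le) hF0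
  have hB₁ : 0 ≤ K₁ * 10 ^ 7 := mul_nonneg hK₁.le (by norm_num)
  have hB₂ : 0 ≤ 3 * ((X₀ : ℝ) + 3) ^ 3 * C := mul_nonneg (mul_nonneg (by norm_num)
    (pow_nonneg (add_nonneg (Nat.cast_nonneg _) (by norm_num)) _)) hC.le
  have hQle : ∀ n ∈ Finset.Icc 1 X,
      (a * (n : ℤ) ^ 2 + b * (n : ℤ) + c).natAbs ≤ 3 * M * X ^ 2 := fun n hn =>
    natAbs_quadratic_le haM hbM hcM (Finset.mem_Icc.mp hn).1 (Finset.mem_Icc.mp hn).2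
  by_cases hbig : X₀ ≤ X ∧ 3 * M ≤ X
  · refine (h₁ a b c f hE hf0 hf1 hfm hfτ X hbig.1 fun n hn => ⟨?_, ?_⟩).trans ?_
    · exact Int.natAbs_ne_zero.mpr (quadratic_ne_zero_of_not_isSquare_discrim hD n)
    · refine (hQle n hn).trans ((Nat.mul_le_mul_right _ hbig.2).trans_eq ?_)
      ring
    · have hE7 : ((2 * a * (b ^ 2 - 4 * a * c)).natAbs : ℝ) ^ 7 ≤ 10 ^ 7 * (M : ℝ) ^ 21 := by
        have h3 : ((2 * a * (b ^ 2 - 4 * a * c)).natAbs : ℝ) ≤ 10 * (M : ℝ) ^ 3 := by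
          exact_mod_cast natAbs_two_mul_mul_discrim_le haM hbM hcM
        refine (pow_le_pow_left₀ (Nat.cast_nonneg _) h3 7).trans_eq ?_
        rw [mul_pow, ← pow_mul]
      calc _ ≤ K₁ * (10 ^ 7 * (M : ℝ) ^ 21) * X * F :=
            mul_le_mul_of_nonneg_right (mul_le_mul_of_nonneg_right
              (mul_le_mul_of_nonneg_left hE7 hK₁.le) hX0.le) hF0
        _ = K₁ * 10 ^ 7 * ((M : ℝ) ^ 21 * X * F) := by ring
        _ ≤ (K₁ * 10 ^ 7 + 3 * ((X₀ : ℝ) + 3) ^ 3 * C) * ((M : ℝ) ^ 21 * X * F) :=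
            mul_le_mul_of_nonneg_right (le_add_of_nonneg_right hB₂) hA0
        _ = _ := by ring
  · have hXM : X ≤ (X₀ + 3) * M := by
      rw [not_and_or, not_le, not_le] at hbig
      rcases hbig with h | h <;> nlinarith
    have hXM' : (X : ℝ) ≤ ((X₀ : ℝ) + 3) * M := by exact_mod_cast hXM
    have hF1 : 1 ≤ C * X * F := by
      have h3 := h₂ a b c X hX
      rw [Real.rpow_one] at h3
      have h4 := exp_neg_two_mul_sum_splitPrimes_le hf0 hε a b c X
      have h5 := mul_le_mul h3 h4 (Real.exp_nonneg _) (mul_nonneg hC.le hX0.le)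
      rwa [← Real.exp_add, add_neg_cancel, Real.exp_zero] at h5
    have hterm : ∀ n ∈ Finset.Icc 1 X,
        f (a * (n : ℤ) ^ 2 + b * (n : ℤ) + c).natAbs ≤ 3 * M * (X : ℝ) ^ 2 := by
      intro n hn
      refine (hfτ _).trans ?_
      exact_mod_cast (Nat.card_divisors_le_self _).trans (hQle n hn)
    calc _ ≤ ((Finset.Icc 1 X).card : ℝ) * (3 * M * (X : ℝ) ^ 2) := by
          rw [← nsmul_eq_mul]
          exact Finset.sum_le_card_nsmul _ _ _ hterm
      _ = 3 * M * X * (X : ℝ) ^ 2 * 1 := by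
          rw [Nat.card_Icc, Nat.add_sub_cancel]
          ring
      _ ≤ 3 * M * X * (X : ℝ) ^ 2 * (C * X * F) := mul_le_mul_of_nonneg_left hF1
          (mul_nonneg (mul_nonneg (mul_nonneg (by norm_num) (Nat.cast_nonneg _)) hX0.le)
            (sq_nonneg _))
      _ = 3 * C * M * X * F * (X : ℝ) ^ 3 := by ring
      _ ≤ 3 * C * M * X * F * (((X₀ : ℝ) + 3) * M) ^ 3 := by
          refine mul_le_mul_of_nonneg_left (pow_le_pow_left₀ hX0.le hXM' 3) ?_
          exact mul_nonneg (mul_nonneg (mul_nonneg (mul_nonneg (by norm_num) hC.le)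
            (Nat.cast_nonneg _)) hX0.le) hF0
      _ = 3 * ((X₀ : ℝ) + 3) ^ 3 * C * ((M : ℝ) ^ 4 * X * F) := by ring
      _ ≤ 3 * ((X₀ : ℝ) + 3) ^ 3 * C * ((M : ℝ) ^ 21 * X * F) := by
          refine mul_le_mul_of_nonneg_left (mul_le_mul_of_nonneg_right
            (mul_le_mul_of_nonneg_right ?_ hX0.le) hF0) hB₂
          exact pow_le_pow_right₀ hM1' (by norm_num)
      _ ≤ (K₁ * 10 ^ 7 + 3 * ((X₀ : ℝ) + 3) ^ 3 * C) * ((M : ℝ) ^ 21 * X * F) :=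
          mul_le_mul_of_nonneg_right (le_add_of_nonneg_left hB₁) hA0
      _ = _ := by ring

/-- Nair-type sieve bound for multiplicative functions dominated by the divisor
function, summed over values of an irreducible quadratic polynomial. -/
theorem stmt_12 :
    ∃ A : ℝ, 0 ≤ A ∧ ∀ ε : ℝ, 0 < ε → ∃ Cε : ℝ, 0 < Cε ∧
      ∀ (lam : ℕ → ℂ) (a b c : ℤ) (k X : ℕ),
        lam 1 = 1 →
        (∀ m n : ℕ, Nat.Coprime m n → lam (m * n) = lam m * lam n) →
        (∀ n : ℕ, ‖lam n‖ ≤ (n.divisors.card : ℝ)) →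
        a ≠ 0 →
        ¬ IsSquare (b ^ 2 - 4 * a * c) →
        3 ≤ k → 1 ≤ X → X ≤ k →
        (∑ n ∈ Finset.Icc 1 X, ‖lam (a * (n : ℤ) ^ 2 + b * (n : ℤ) + c).natAbs‖) ≤
          Cε * ((max (max a.natAbs b.natAbs) c.natAbs : ℕ) : ℝ) ^ A * (X : ℝ) *
            Real.exp (∑ p ∈ (Finset.Icc 1 X).filter
              (fun p : ℕ => p.Prime ∧ ¬ ((p : ℤ) ∣ 2 * a * (b ^ 2 - 4 * a * c)) ∧
                ∃ t : ℤ, ¬ ((p : ℤ) ∣ t) ∧ (p : ℤ) ∣ (b ^ 2 - 4 * a * c - t ^ 2)),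
              (2 * (‖lam p‖ - 1) + ε) / (p : ℝ)) := by
  refine ⟨21, by norm_num, fun ε hε => ?_⟩
  obtain ⟨K, hK, h⟩ := exists_sum_apply_quadratic_le_max hε
  refine ⟨K, hK, ?_⟩
  intro lam a b c k X h1 hmul hτ ha hD _ hX _
  refine (h a b c (fun n => ‖lam n‖) ha hD (fun _ => norm_nonneg _) (by simp [h1])
    (fun m n hmn => by simp [hmul m n hmn]) hτ X hX).trans_eq ?_
  rw [Real.rpow_ofNat, ← Real.exp_add]
  congr 2
  rw [Finset.mul_sum, ← Finset.sum_add_distrib]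
  refine Finset.sum_congr ?_ fun p _ => by ring
  ext p
  simp only [splitPrimes, IsSplitPrime, Finset.mem_filter]
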